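/- Let N ≥ 2, let f satisfy (H2), let u be any bounded nonnegative solution of problem (eq) in the quarter-space Ω with boundary datum u₀ ≢ 0, and define M = lim_{A→+∞} sup_{[A,+∞)×ℝ^{N-2}×[0,+∞)} u. Then 0 < M < +∞ and f(M) = 0. -/

import Mathlib

open Set Filter

noncomputable section

/-- Partial derivative of `u` in the `i`-th coordinate direction. -/
def pd {N : ℕ} (i : Fin N) (u : (Fin N → ℝ) → ℝ) (x : Fin N → ℝ) : ℝ :=
  deriv (fun t => u (Function.update x i t)) (x i)

/-- Laplace operator: the sum of the pure second partial derivatives. -/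
def lap {N : ℕ} (u : (Fin N → ℝ) → ℝ) (x : Fin N → ℝ) : ℝ :=
  ∑ i, pd i (pd i u) x

/-- `f` is locally Lipschitz-continuous on `[0, +∞)`. -/
def LocLipOn (f : ℝ → ℝ) : Prop :=
  ∀ b : ℝ, ∃ L : NNReal, LipschitzOnWith L f (Set.Icc 0 b)

/-- Hypothesis (H1): `f` is locally Lipschitz on `[0,∞)`, positive on `(0,μ)`, nonpositive on
`[μ,∞)`, nonincreasing on `[μ',μ]`, and either `f(0) > 0` or `f(0) = 0` with
`liminf_{s→0⁺} f(s)/s > 0`. -/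
def H1 (f : ℝ → ℝ) (μ' μ : ℝ) : Prop :=
  LocLipOn f ∧ 0 < μ' ∧ μ' < μ ∧
  (∀ s, 0 < s → s < μ → 0 < f s) ∧
  (∀ s, μ ≤ s → f s ≤ 0) ∧
  (∀ s t, μ' ≤ s → s ≤ t → t ≤ μ → f t ≤ f s) ∧
  (0 < f 0 ∨ (f 0 = 0 ∧ ∃ c > 0, ∀ᶠ s in nhdsWithin (0:ℝ) (Set.Ioi 0), c ≤ f s / s))

/-- Hypothesis (H2): `f` is locally Lipschitz and nonnegative on `[0,∞)`, and at every
nonnegative zero `z` of `f`, `liminf_{s→z⁺} f(s)/(s-z) > 0`. -/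
def H2 (f : ℝ → ℝ) : Prop :=
  LocLipOn f ∧ (∀ s, 0 ≤ s → 0 ≤ f s) ∧
  (∀ z, 0 ≤ z → f z = 0 → ∃ c > 0, ∀ᶠ s in nhdsWithin z (Set.Ioi z), c ≤ f s / (s - z))

/-- Hypothesis (H3): `liminf_{s→z⁻} f(s)/(s-z) > 0` for every zero `z > μ` of `f`. -/
def H3 (f : ℝ → ℝ) (μ : ℝ) : Prop :=
  ∀ z, μ < z → f z = 0 → ∃ c > 0, ∀ᶠ s in nhdsWithin z (Set.Iio z), c ≤ f s / (s - z)

/-- `(V, V')` is a `C²` solution on `[0,+∞)` of `V'' + f(V) = 0` with `V(0) = 0`,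
`0 < V < z` on `(0,+∞)` and `V(+∞) = z` (the one-dimensional profile `V_z`). -/
def IsProfile (f : ℝ → ℝ) (z : ℝ) (V V' : ℝ → ℝ) : Prop :=
  (∀ ξ ∈ Set.Ici (0:ℝ), HasDerivWithinAt V (V' ξ) (Set.Ici 0) ξ) ∧
  (∀ ξ ∈ Set.Ici (0:ℝ), HasDerivWithinAt V' (-(f (V ξ))) (Set.Ici 0) ξ) ∧
  V 0 = 0 ∧ (∀ ξ, 0 < ξ → 0 < V ξ ∧ V ξ < z) ∧
  Filter.Tendsto V Filter.atTop (nhds z)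

/-- The translates `x ↦ u(x + h e₁)` converge as `h → +∞`, uniformly on `K` together with all
partial derivatives up to order two, to the limits `w`, `w1 i`, `w2 i j`. -/
def C2ConvOn {N : ℕ} (i0 : Fin N) (u : (Fin N → ℝ) → ℝ) (K : Set (Fin N → ℝ))
    (w : (Fin N → ℝ) → ℝ) (w1 : Fin N → (Fin N → ℝ) → ℝ)
    (w2 : Fin N → Fin N → (Fin N → ℝ) → ℝ) : Prop :=
  TendstoUniformlyOn (fun (h : ℝ) x => u (Function.update x i0 (x i0 + h))) w
    Filter.atTop K ∧
  (∀ i, TendstoUniformlyOn (fun (h : ℝ) x => pd i u (Function.update x i0 (x i0 + h)))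
      (w1 i) Filter.atTop K) ∧
  (∀ i j, TendstoUniformlyOn
      (fun (h : ℝ) x => pd i (pd j u) (Function.update x i0 (x i0 + h)))
      (w2 i j) Filter.atTop K)

/-- `F(z) = ∫₀^z f(σ) dσ`. -/
def Ff (f : ℝ → ℝ) (z : ℝ) : ℝ := ∫ σ in (0:ℝ)..z, f σ

/-- The set `Z_f = {z₀ ≥ 0 : f(z₀) = 0 and F(z) < F(z₀) for all z ∈ [0,z₀)}`. -/
def Zf (f : ℝ → ℝ) : Set ℝ :=
  {z | 0 ≤ z ∧ f z = 0 ∧ ∀ w, 0 ≤ w → w < z → Ff f w < Ff f z}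

/-- `(V, V')` belongs to `R_f`: a bounded nonnegative `C²` solution on `[0,∞)` of
`V'' + f(V) = 0` with `V(0) = 0`. -/
def InRf (f V V' : ℝ → ℝ) : Prop :=
  (∀ ξ ∈ Set.Ici (0:ℝ), HasDerivWithinAt V (V' ξ) (Set.Ici 0) ξ) ∧
  (∀ ξ ∈ Set.Ici (0:ℝ), HasDerivWithinAt V' (-(f (V ξ))) (Set.Ici 0) ξ) ∧
  V 0 = 0 ∧ (∀ ξ, 0 ≤ ξ → 0 ≤ V ξ) ∧ (∃ C, ∀ ξ, 0 ≤ ξ → V ξ ≤ C)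

/-! ### One-dimensional lines and the coordinate Laplacian -/

theorem lap_eq_sum_deriv_deriv {N : ℕ} (u : (Fin N → ℝ) → ℝ) (x : Fin N → ℝ) :
    lap u x = ∑ i, deriv (deriv fun t => u (Function.update x i t)) (x i) := by
  unfold lap
  refine Finset.sum_congr rfl fun i _ => ?_
  unfold pd
  congr 1
  funext t
  simp [Function.update_idem, Function.update_self]

theorem contDiffAt_line {N : ℕ} {u : (Fin N → ℝ) → ℝ} {x : Fin N → ℝ}
    (h : ContDiffAt ℝ 2 u x) (i : Fin N) :
    ContDiffAt ℝ 2 (fun t => u (Function.update x i t)) (x i) := by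
  have h1 : ContDiffAt ℝ 2 (Function.update x i) (x i) := (contDiff_update 2 x i).contDiffAt
  have h2 : ContDiffAt ℝ 2 u (Function.update x i (x i)) := by
    rwa [Function.update_eq_self]
  exact h2.comp (x i) h1

theorem lap_sub {N : ℕ} {u v : (Fin N → ℝ) → ℝ} {x : Fin N → ℝ}
    (hu : ContDiffAt ℝ 2 u x) (hv : ContDiffAt ℝ 2 v x) :
    lap (fun y => u y - v y) x = lap u x - lap v x := by
  simp only [lap_eq_sum_deriv_deriv, ← Finset.sum_sub_distrib]
  refine Finset.sum_congr rfl fun i _ => ?_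
  have := iteratedDeriv_fun_sub (n := 2) (contDiffAt_line hu i) (contDiffAt_line hv i)
  simpa only [iteratedDeriv_succ, iteratedDeriv_zero] using this

theorem lap_add {N : ℕ} {u v : (Fin N → ℝ) → ℝ} {x : Fin N → ℝ}
    (hu : ContDiffAt ℝ 2 u x) (hv : ContDiffAt ℝ 2 v x) :
    lap (fun y => u y + v y) x = lap u x + lap v x := by
  simp only [lap_eq_sum_deriv_deriv, ← Finset.sum_add_distrib]
  refine Finset.sum_congr rfl fun i _ => ?_
  have := iteratedDeriv_fun_add (n := 2) (contDiffAt_line hu i) (contDiffAt_line hv i)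
  simpa only [iteratedDeriv_succ, iteratedDeriv_zero] using this

theorem deriv_deriv_nonneg_of_isLocalMin {h : ℝ → ℝ} {t : ℝ} (hc : ContinuousAt h t)
    (hm : IsLocalMin h t) : 0 ≤ deriv (deriv h) t := by
  by_contra! hneg
  have hmax := isLocalMax_of_deriv_deriv_neg hneg hm.deriv_eq_zero hc
  have hconst : h =ᶠ[nhds t] fun _ => h t := by
    filter_upwards [hm, hmax] with s h1 h2 using le_antisymm h2 h1
  have h0 : deriv (deriv h) t = 0 := by
    rw [(hconst.deriv).deriv_eq]
    simp
  linarith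

theorem lap_nonneg_of_isLocalMin {N : ℕ} {w : (Fin N → ℝ) → ℝ} {x : Fin N → ℝ}
    (hw : ContDiffAt ℝ 2 w x) (hm : IsLocalMin w x) : 0 ≤ lap w x := by
  rw [lap_eq_sum_deriv_deriv]
  refine Finset.sum_nonneg fun i _ => ?_
  refine deriv_deriv_nonneg_of_isLocalMin (contDiffAt_line hw i).continuousAt ?_
  have hc : ContinuousAt (fun t : ℝ => Function.update x i t) (x i) :=
    (contDiff_update (𝕜 := ℝ) 2 x i).continuous.continuousAt
  have ht : Tendsto (fun t : ℝ => Function.update x i t) (nhds (x i)) (nhds x) := by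
    have := hc.tendsto
    rwa [Function.update_eq_self] at this
  have := ht.eventually hm
  filter_upwards [this] with t ht
  simpa [Function.update_eq_self] using ht

theorem lap_eq_sum_of_hasDerivAt {N : ℕ} {u : (Fin N → ℝ) → ℝ} {x : Fin N → ℝ}
    {p : Fin N → ℝ → ℝ} {a : Fin N → ℝ}
    (h1 : ∀ i t, HasDerivAt (fun t => u (Function.update x i t)) (p i t) t)
    (h2 : ∀ i, HasDerivAt (p i) (a i) (x i)) : lap u x = ∑ i, a i := by
  rw [lap_eq_sum_deriv_deriv]
  refine Finset.sum_congr rfl fun i _ => ?_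
  have : (deriv fun t => u (Function.update x i t)) = p i := funext fun t => (h1 i t).deriv
  rw [this, (h2 i).deriv]

/-- Reflection of the `i`-th coordinate about the value `l`. -/
def mirror {N : ℕ} (i : Fin N) (l : ℝ) (x : Fin N → ℝ) : Fin N → ℝ :=
  Function.update x i (2 * l - x i)

theorem contDiff_mirror {N : ℕ} (i : Fin N) (l : ℝ) : ContDiff ℝ 2 (mirror i l) := by
  rw [contDiff_pi]
  intro j
  by_cases h : j = i
  · subst h
    simp only [mirror, Function.update_self]
    fun_prop
  · simp only [mirror, Function.update_of_ne h]
    fun_prop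

theorem lap_comp_mirror {N : ℕ} (u : (Fin N → ℝ) → ℝ) (i : Fin N) (l : ℝ) (x : Fin N → ℝ) :
    lap (fun y => u (mirror i l y)) x = lap u (mirror i l x) := by
  simp only [lap_eq_sum_deriv_deriv]
  refine Finset.sum_congr rfl fun j _ => ?_
  by_cases h : j = i
  · subst h
    have e1 : (fun t => u (mirror j l (Function.update x j t)))
        = fun t => (fun s => u (Function.update (mirror j l x) j s)) (2 * l - t) := by
      funext t
      simp [mirror]
    have e2 : (mirror j l x) j = 2 * l - x j := by simp [mirror]
    rw [e1, e2]
    set g : ℝ → ℝ := fun s => u (Function.update (mirror j l x) j s)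
    have e3 : (deriv fun t => g (2 * l - t)) = fun t => -deriv g (2 * l - t) := by
      funext t
      exact deriv_comp_const_sub g (2 * l) t
    rw [e3, deriv.fun_neg, deriv_comp_const_sub (deriv g), neg_neg]
  · have e2 : (mirror i l x) j = x j := by simp [mirror, h]
    rw [e2]
    congr 2
    funext t
    congr 1
    simp only [mirror]
    rw [Function.update_of_ne (Ne.symm h), Function.update_comm h]

/-- Squared Euclidean distance. -/
def sqd {N : ℕ} (x c : Fin N → ℝ) : ℝ := ∑ j, (x j - c j) ^ 2

/-- Squared Euclidean distance of the projections along the `i`-th coordinate. -/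
def rho {N : ℕ} (i : Fin N) (x c : Fin N → ℝ) : ℝ := ∑ j ∈ Finset.univ.erase i, (x j - c j) ^ 2

theorem sqd_eq {N : ℕ} (i : Fin N) (x c : Fin N → ℝ) : sqd x c = (x i - c i) ^ 2 + rho i x c := by
  unfold sqd rho
  exact (Finset.add_sum_erase _ (fun j => (x j - c j) ^ 2) (Finset.mem_univ i)).symm

theorem rho_nonneg {N : ℕ} (i : Fin N) (x c : Fin N → ℝ) : 0 ≤ rho i x c :=
  Finset.sum_nonneg fun _ _ => sq_nonneg _

theorem sqd_nonneg {N : ℕ} (x c : Fin N → ℝ) : 0 ≤ sqd x c :=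
  Finset.sum_nonneg fun _ _ => sq_nonneg _

theorem sq_le_sqd {N : ℕ} (i : Fin N) (x c : Fin N → ℝ) : (x i - c i) ^ 2 ≤ sqd x c := by
  rw [sqd_eq i]
  linarith [rho_nonneg i x c]

theorem sq_le_rho {N : ℕ} {i j : Fin N} (h : j ≠ i) (x c : Fin N → ℝ) :
    (x j - c j) ^ 2 ≤ rho i x c :=
  Finset.single_le_sum (f := fun j => (x j - c j) ^ 2) (fun _ _ => sq_nonneg _)
    (Finset.mem_erase.2 ⟨h, Finset.mem_univ j⟩)

theorem rho_update_self {N : ℕ} (i : Fin N) (x c : Fin N → ℝ) (t : ℝ) :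
    rho i (Function.update x i t) c = rho i x c := by
  unfold rho
  refine Finset.sum_congr rfl fun j hj => ?_
  rw [Function.update_of_ne (Finset.ne_of_mem_erase hj)]

theorem sqd_update {N : ℕ} (i : Fin N) (x c : Fin N → ℝ) (t : ℝ) :
    sqd (Function.update x i t) c = (t - c i) ^ 2 + rho i x c := by
  rw [sqd_eq i, rho_update_self, Function.update_self]

theorem rho_update_of_ne {N : ℕ} {i j : Fin N} (h : j ≠ i) (x c : Fin N → ℝ) (t : ℝ) :
    rho i (Function.update x j t) c = (t - c j) ^ 2 + (rho i x c - (x j - c j) ^ 2) := by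
  have h1 := sqd_eq i (Function.update x j t) c
  have h2 := sqd_update j x c t
  have h3 := sqd_eq i x c
  have h4 := sqd_eq j x c
  rw [Function.update_of_ne h.symm] at h1
  linarith

theorem rho_self {N : ℕ} (i : Fin N) (x : Fin N → ℝ) : rho i x x = 0 := by
  simp [rho]

theorem sqd_self {N : ℕ} (x : Fin N → ℝ) : sqd x x = 0 := by
  simp [sqd]

theorem contDiff_sqd {N : ℕ} (c : Fin N → ℝ) : ContDiff ℝ 2 fun x => sqd x c := by
  unfold sqd
  fun_prop

theorem contDiff_rho {N : ℕ} (i : Fin N) (c : Fin N → ℝ) : ContDiff ℝ 2 fun x => rho i x c := by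
  unfold rho
  fun_prop

theorem lap_radial {N : ℕ} {g g' g'' : ℝ → ℝ} (h1 : ∀ s, HasDerivAt g (g' s) s)
    (h2 : ∀ s, HasDerivAt g' (g'' s) s) (c x : Fin N → ℝ) :
    lap (fun y => g (sqd y c)) x = 4 * sqd x c * g'' (sqd x c) + 2 * N * g' (sqd x c) := by
  rw [lap_eq_sum_of_hasDerivAt
    (p := fun i t => g' ((t - c i) ^ 2 + rho i x c) * (2 * (t - c i)))
    (a := fun i => g'' (sqd x c) * (2 * (x i - c i)) * (2 * (x i - c i)) + g' (sqd x c) * 2)]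
  · have e : ∀ i : Fin N, g'' (sqd x c) * (2 * (x i - c i)) * (2 * (x i - c i)) + g' (sqd x c) * 2
        = 4 * g'' (sqd x c) * (x i - c i) ^ 2 + g' (sqd x c) * 2 := fun i => by ring
    simp only [e, Finset.sum_add_distrib, ← Finset.mul_sum]
    have : ∑ i, (x i - c i) ^ 2 = sqd x c := rfl
    rw [this]
    simp
    ring
  · intro i t
    simp only [sqd_update]
    have hs : HasDerivAt (fun t : ℝ => (t - c i) ^ 2 + rho i x c) (2 * (t - c i)) t := by
      have := (((hasDerivAt_id t).sub_const (c i)).pow 2).add_const (rho i x c)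
      simpa using this
    exact (h1 _).comp t hs
  · intro i
    have hs : HasDerivAt (fun t : ℝ => (t - c i) ^ 2 + rho i x c) (2 * (x i - c i)) (x i) := by
      have := (((hasDerivAt_id (x i)).sub_const (c i)).pow 2).add_const (rho i x c)
      simpa using this
    have hl : HasDerivAt (fun t : ℝ => 2 * (t - c i)) 2 (x i) := by
      have := ((hasDerivAt_id (x i)).sub_const (c i)).const_mul 2
      simpa using this
    have h3 := ((h2 ((x i - c i) ^ 2 + rho i x c)).comp (x i) hs).mul hl
    rw [← sqd_eq] at h3
    refine h3.congr_deriv ?_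
    simp only [Function.comp]
    rw [← sqd_eq]

theorem lap_cylindrical {N : ℕ} {P P' P'' Q Q' Q'' : ℝ → ℝ} (hP : ∀ s, HasDerivAt P (P' s) s)
    (hP' : ∀ s, HasDerivAt P' (P'' s) s) (hQ : ∀ s, HasDerivAt Q (Q' s) s)
    (hQ' : ∀ s, HasDerivAt Q' (Q'' s) s) (i : Fin N) (c x : Fin N → ℝ) :
    lap (fun y => P (y i) + Q (y i) * rho i y c) x
      = P'' (x i) + Q'' (x i) * rho i x c + 2 * (N - 1) * Q (x i) := by
  rw [lap_eq_sum_of_hasDerivAt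
    (p := fun j t => if j = i then P' t + Q' t * rho i x c else Q (x i) * (2 * (t - c j)))
    (a := fun j => if j = i then P'' (x i) + Q'' (x i) * rho i x c else Q (x i) * 2)]
  · rw [← Finset.add_sum_erase _ _ (Finset.mem_univ i)]
    have : ∑ j ∈ Finset.univ.erase i,
        (if j = i then P'' (x i) + Q'' (x i) * rho i x c else Q (x i) * 2)
        = ∑ j ∈ Finset.univ.erase i, Q (x i) * 2 :=
      Finset.sum_congr rfl fun j hj => if_neg (Finset.ne_of_mem_erase hj)
    rw [this]
    have hN : 1 ≤ N := Nat.one_le_iff_ne_zero.2 (by rintro rfl; exact i.elim0)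
    simp [Finset.card_erase_of_mem, Nat.cast_sub hN]
    ring
  · intro j t
    by_cases h : j = i
    · subst h
      simp only [if_true, Function.update_self, rho_update_self]
      exact (hP t).add ((hQ t).mul_const _)
    · simp only [if_neg h, Function.update_of_ne (Ne.symm h), rho_update_of_ne h]
      have := (((((hasDerivAt_id t).sub_const (c j)).pow 2).add_const
        (rho i x c - (x j - c j) ^ 2)).const_mul (Q (x i))).const_add (P (x i))
      simpa using this
  · intro j
    by_cases h : j = i
    · subst h
      simp only [if_true]
      exact (hP' _).add ((hQ' _).mul_const _)
    · simp only [if_neg h]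
      have := ((((hasDerivAt_id (x j)).sub_const (c j)).const_mul 2)).const_mul (Q (x i))
      simpa using this

/-! ### Maximum principles -/

theorem isCompact_of_abs_sub_le {N : ℕ} {K : Set (Fin N → ℝ)} (hK : IsClosed K) {c : Fin N → ℝ}
    {L : ℝ} (h : ∀ x ∈ K, ∀ j, |x j - c j| ≤ L) : IsCompact K := by
  refine (isCompact_univ_pi fun j => isCompact_Icc (a := c j - L) (b := c j + L)).of_isClosed_subset
    hK fun x hx j _ => ?_
  have := abs_le.1 (h x hx j)
  exact ⟨by linarith, by linarith⟩

theorem isCompact_sqd_le {N : ℕ} (c : Fin N → ℝ) (R : ℝ) : IsCompact {x | sqd x c ≤ R ^ 2} := by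
  refine isCompact_of_abs_sub_le (c := c) (L := |R|)
    (isClosed_le (contDiff_sqd c).continuous continuous_const) fun x hx j => ?_
  exact sq_le_sq.1 ((sq_le_sqd j x c).trans hx)

theorem isCompact_cylinder {N : ℕ} (i : Fin N) (c : Fin N → ℝ) (L a b : ℝ) :
    IsCompact {x | rho i x c ≤ L ^ 2 ∧ a ≤ x i ∧ x i ≤ b} := by
  refine isCompact_of_abs_sub_le (c := c) (L := max |L| (max |b - c i| |a - c i|)) ?_
    fun x hx j => ?_
  · exact (isClosed_le (contDiff_rho i c).continuous continuous_const).inter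
      ((isClosed_le continuous_const (continuous_apply i)).inter
        (isClosed_le (continuous_apply i) continuous_const))
  · by_cases h : j = i
    · subst h
      refine le_max_of_le_right ?_
      rw [abs_le]
      have h1 := le_abs_self (b - c j)
      have h2 := neg_abs_le (a - c j)
      have h3 := le_max_left |b - c j| |a - c j|
      have h4 := le_max_right |b - c j| |a - c j|
      exact ⟨by linarith [hx.2.1], by linarith [hx.2.2]⟩
    · exact le_max_of_le_left (sq_le_sq.1 ((sq_le_rho h x c).trans hx.1))

theorem nonneg_of_lap_neg {N : ℕ} {K : Set (Fin N → ℝ)} (hK : IsCompact K)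
    {w : (Fin N → ℝ) → ℝ} (hw : ContinuousOn w K)
    (h : ∀ x ∈ K, w x < 0 → K ∈ nhds x ∧ ContDiffAt ℝ 2 w x ∧ lap w x < 0) :
    ∀ x ∈ K, 0 ≤ w x := by
  intro x hx
  obtain ⟨z, hz, hmin⟩ := hK.exists_isMinOn ⟨x, hx⟩ hw
  refine le_trans ?_ (hmin hx)
  by_contra! hneg
  obtain ⟨h1, h2, h3⟩ := h z hz hneg
  exact absurd (lap_nonneg_of_isLocalMin h2 (hmin.isLocalMin h1)) (not_le.2 h3)

theorem exists_superharmonic_spread (N : ℕ) {r ρ : ℝ} (hρ : 0 < ρ) (hr : 0 < r) :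
    ∃ k : ℕ, ∀ (w : (Fin N → ℝ) → ℝ) (c : Fin N → ℝ) (η : ℝ), 0 < η →
      ContinuousOn w {x | sqd x c ≤ r ^ 2} →
      (∀ x, sqd x c < r ^ 2 → ContDiffAt ℝ 2 w x ∧ lap w x ≤ 0) →
      (∀ x, sqd x c ≤ r ^ 2 → 0 ≤ w x) → (∀ x, sqd x c ≤ ρ ^ 2 → sqd x c ≤ r ^ 2 → η ≤ w x) →
      ∀ x, sqd x c ≤ r ^ 2 → η * ((r ^ 2 - sqd x c) / r ^ 2) ^ k ≤ w x := by
  obtain ⟨n, hn⟩ := exists_nat_gt (2 * N * r ^ 2 / (4 * ρ ^ 2))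
  rw [div_lt_iff₀ (by positivity)] at hn
  refine ⟨n + 2, fun w c η hη hwc hw hw0 hwη x hx => ?_⟩
  have hr2 : 0 < r ^ 2 := by positivity
  set ψ : (Fin N → ℝ) → ℝ := fun x => η * ((r ^ 2 - sqd x c) / r ^ 2) ^ (n + 2) with hψ
  have hψd : ContDiff ℝ 2 ψ := by
    have := contDiff_sqd c
    fun_prop
  have hlap : ∀ x, lap ψ x = η * (n + 2) * ((r ^ 2 - sqd x c) / r ^ 2) ^ n / r ^ 2 *
      (4 * sqd x c * (n + 1) / r ^ 2 - 2 * N * ((r ^ 2 - sqd x c) / r ^ 2)) := by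
    intro x
    have hb : ∀ s : ℝ, HasDerivAt (fun s => (r ^ 2 - s) / r ^ 2) (-1 / r ^ 2) s := fun s => by
      simpa using ((hasDerivAt_id s).const_sub (r ^ 2)).div_const (r ^ 2)
    have := lap_radial (g := fun s => η * ((r ^ 2 - s) / r ^ 2) ^ (n + 2))
      (g' := fun s => η * ((n + 2 : ℝ) * ((r ^ 2 - s) / r ^ 2) ^ (n + 1) * (-1 / r ^ 2)))
      (g'' := fun s => η * ((n + 2 : ℝ) * ((n + 1 : ℝ) * ((r ^ 2 - s) / r ^ 2) ^ n * (-1 / r ^ 2))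
        * (-1 / r ^ 2)))
      (fun s => by
        have := ((hb s).pow (n + 2)).const_mul η
        refine this.congr_deriv ?_
        push_cast
        simp) (fun s => by
        have := ((((hb s).pow (n + 1)).const_mul ((n : ℝ) + 2)).mul_const (-1 / r ^ 2)).const_mul η
        refine this.congr_deriv ?_
        push_cast
        simp) c x
    rw [hψ, this]
    generalize (r ^ 2 - sqd x c) / r ^ 2 = Y
    field_simp
    ring
  have key := nonneg_of_lap_neg (isCompact_sqd_le c r) (w := fun x => w x - ψ x)
    (hwc.sub hψd.continuous.continuousOn) ?_ x hx
  · simpa [hψ] using key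
  intro z hz hneg
  have hz' : sqd z c ≤ r ^ 2 := hz
  have hlt : sqd z c < r ^ 2 := by
    refine lt_of_le_of_ne hz' fun he => ?_
    have := hw0 z hz'
    simp only [hψ, he] at hneg
    simp at hneg
    linarith
  have hy0 : 0 < (r ^ 2 - sqd z c) / r ^ 2 := div_pos (by linarith) hr2
  have hy1 : (r ^ 2 - sqd z c) / r ^ 2 ≤ 1 := by
    rw [div_le_one hr2]
    linarith [sqd_nonneg z c]
  have hgt : ρ ^ 2 < sqd z c := by
    by_contra! hle
    have h1 := hwη z hle hz'
    have h2 : ψ z ≤ η * 1 := mul_le_mul_of_nonneg_left (pow_le_one₀ hy0.le hy1) hη.le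
    linarith
  refine ⟨?_, (hw z hlt).1.sub hψd.contDiffAt, ?_⟩
  · exact Filter.mem_of_superset ((isOpen_lt (contDiff_sqd c).continuous
      continuous_const).mem_nhds hlt) fun y (hy : sqd y c < r ^ 2) => (show sqd y c ≤ r ^ 2 from hy.le)
  · rw [lap_sub (hw z hlt).1 hψd.contDiffAt, hlap]
    have h1 := (hw z hlt).2
    have h2 : 0 < 4 * sqd z c * (n + 1) / r ^ 2 - 2 * N * ((r ^ 2 - sqd z c) / r ^ 2) := by
      have h3 : 2 * N * ((r ^ 2 - sqd z c) / r ^ 2) ≤ 2 * N * 1 :=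
        mul_le_mul_of_nonneg_left hy1 (by positivity)
      have h4 : 2 * N * 1 < 4 * sqd z c * (n + 1) / r ^ 2 := by
        rw [lt_div_iff₀ hr2]
        nlinarith [mul_le_mul_of_nonneg_left hgt.le (Nat.cast_nonneg (α := ℝ) n),
          sq_nonneg ρ]
      linarith
    have h5 : 0 < η * (n + 2) * ((r ^ 2 - sqd z c) / r ^ 2) ^ n / r ^ 2 *
      (4 * sqd z c * (n + 1) / r ^ 2 - 2 * N * ((r ^ 2 - sqd z c) / r ^ 2)) := by
      positivity
    linarith

/-! ### Sliding a compactly supported subsolution -/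

theorem lap_bump_add_ge {N : ℕ} {c R ε : ℝ} (hR : 0 < R) (hcR : c * R ^ 2 = (N + 2) ^ 2)
    (hε : 0 < ε) (a : ℝ) (y x : Fin N → ℝ) :
    4 * ε / R ^ 2 ≤ lap (fun x => a + ε * (1 - sqd x y / R ^ 2) ^ 2) x
      + c * (ε * (1 - sqd x y / R ^ 2) ^ 2) := by
  have hb : ∀ s : ℝ, HasDerivAt (fun s => 1 - s / R ^ 2) (-(1 / R ^ 2)) s := fun s =>
    ((hasDerivAt_id s).div_const (R ^ 2)).const_sub 1
  have := lap_radial (g := fun s => a + ε * (1 - s / R ^ 2) ^ 2)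
    (g' := fun s => ε * (2 * (1 - s / R ^ 2) * (-(1 / R ^ 2))))
    (g'' := fun s => ε * (2 * (-(1 / R ^ 2)) * (-(1 / R ^ 2))))
    (fun s => by
      have := ((((hb s).pow 2).const_mul ε)).const_add a
      refine this.congr_deriv ?_
      push_cast
      simp) (fun s => (((hb s).const_mul 2).mul_const _).const_mul ε) y x
  rw [this]
  have hc : c = (N + 2) ^ 2 / R ^ 2 := by rw [← hcR]; field_simp
  set z := sqd x y / R ^ 2 with hz
  have hs : sqd x y = z * R ^ 2 := by rw [hz]; field_simp
  rw [hc, hs]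
  have e : 4 * (z * R ^ 2) * (ε * (2 * (-(1 / R ^ 2)) * (-(1 / R ^ 2)))) +
      2 * N * (ε * (2 * (1 - z) * (-(1 / R ^ 2)))) + (N + 2) ^ 2 / R ^ 2 * (ε * (1 - z) ^ 2)
      = (ε * (((N + 2) * (1 - z) - 2) ^ 2 + 4)) / R ^ 2 := by
    field_simp
    ring
  rw [e]
  refine div_le_div_of_nonneg_right ?_ (by positivity)
  nlinarith [mul_nonneg hε.le (sq_nonneg (((N : ℝ) + 2) * (1 - z) - 2))]

theorem bump_lt_of_homotopy {N : ℕ} {f : ℝ → ℝ} {u : (Fin N → ℝ) → ℝ} {D : Set (Fin N → ℝ)}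
    {a c e R ε₁ : ℝ} (hu : ∀ x ∈ D, ContDiffAt ℝ 2 u x ∧ lap u x + f (u x) = 0 ∧ a < u x)
    (hf : ∀ s, 0 ≤ s → s ≤ ε₁ → c * (s - e) ≤ f (a + s))
    (hR : 0 < R) (hcR : c * R ^ 2 = (N + 2) ^ 2) {ε : ℝ → ℝ} {y : ℝ → Fin N → ℝ}
    (hεc : Continuous ε) (hyc : Continuous y)
    (hε : ∀ t ∈ Icc (0 : ℝ) 1, 0 < ε t ∧ ε t ≤ ε₁ ∧ c * e * R ^ 2 < 4 * ε t)
    (hyD : ∀ t ∈ Icc (0 : ℝ) 1, ∀ x, sqd x (y t) ≤ R ^ 2 → x ∈ D)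
    (h0 : ∀ x, sqd x (y 0) ≤ R ^ 2 → a + ε 0 * (1 - sqd x (y 0) / R ^ 2) ^ 2 < u x) :
    ∀ x, sqd x (y 1) ≤ R ^ 2 → a + ε 1 * (1 - sqd x (y 1) / R ^ 2) ^ 2 < u x := by
  by_contra! hbad
  obtain ⟨x₁, hx₁, hbad₁⟩ := hbad
  have hR2 : 0 < R ^ 2 := by positivity
  have hsc : Continuous fun p : ℝ × (Fin N → ℝ) => sqd p.2 (y p.1) := by
    unfold sqd
    fun_prop
  set F : ℝ × (Fin N → ℝ) → ℝ := fun p =>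
    u p.2 - (a + ε p.1 * (1 - sqd p.2 (y p.1) / R ^ 2) ^ 2) with hF
  set T : Set (ℝ × (Fin N → ℝ)) := {p | p.1 ∈ Icc (0 : ℝ) 1 ∧ sqd p.2 (y p.1) ≤ R ^ 2} with hT
  have hTc : IsCompact T := by
    have h1 : IsCompact ((Icc (0 : ℝ) 1) ×ˢ {z : Fin N → ℝ | sqd z 0 ≤ R ^ 2}) :=
      isCompact_Icc.prod (isCompact_sqd_le 0 R)
    have h2 : T ⊆ (fun p : ℝ × (Fin N → ℝ) => (p.1, y p.1 + p.2)) ''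
        ((Icc (0 : ℝ) 1) ×ˢ {z : Fin N → ℝ | sqd z 0 ≤ R ^ 2}) := by
      rintro ⟨t, x⟩ ⟨ht, hx⟩
      refine ⟨(t, x - y t), ⟨ht, ?_⟩, by simp⟩
      simpa [sqd] using hx
    refine (h1.image (by fun_prop)).of_isClosed_subset ?_ h2
    exact (isClosed_Icc.preimage continuous_fst).inter (isClosed_le hsc continuous_const)
  have hFc : ContinuousOn F T := by
    have h1 : ContinuousOn (fun p : ℝ × (Fin N → ℝ) => u p.2) T := by
      intro p hp
      have := (hu p.2 (hyD p.1 hp.1 p.2 hp.2)).1.continuousAt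
      exact (ContinuousAt.comp (f := fun p : ℝ × (Fin N → ℝ) => p.2) this
        continuous_snd.continuousAt).continuousWithinAt
    exact h1.sub (by fun_prop)
  have hSc : IsCompact (T ∩ F ⁻¹' Iic 0) :=
    hTc.of_isClosed_subset (hFc.preimage_isClosed_of_isClosed hTc.isClosed isClosed_Iic)
      inter_subset_left
  have hne : (T ∩ F ⁻¹' Iic 0).Nonempty :=
    ⟨(1, x₁), ⟨⟨⟨zero_le_one, le_refl _⟩, hx₁⟩, by simpa [hF] using hbad₁⟩⟩
  obtain ⟨⟨t, x⟩, ⟨⟨ht, hx⟩, hFx⟩, hmin⟩ := hSc.exists_isMinOn hne continuous_fst.continuousOn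
  simp only at ht hx
  have hFx' : u x ≤ a + ε t * (1 - sqd x (y t) / R ^ 2) ^ 2 := by
    have : F (t, x) ≤ 0 := hFx
    simp only [hF] at this
    linarith
  have hlt : sqd x (y t) < R ^ 2 := by
    refine lt_of_le_of_ne hx fun he => ?_
    rw [he, div_self hR2.ne'] at hFx'
    have := (hu x (hyD t ht x hx)).2.2
    simp at hFx'
    linarith
  have ht0 : 0 < t := by
    refine lt_of_le_of_ne ht.1 fun he => ?_
    subst he
    exact absurd (h0 x hx) (not_lt.2 hFx')
  have hnear : ∀ z, sqd z (y t) < R ^ 2 → 0 ≤ F (t, z) := by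
    intro z hz
    have h1 : Tendsto (fun s => F (s, z)) (nhdsWithin t (Iio t)) (nhds (F (t, z))) := by
      have hcont : Continuous fun s => F (s, z) := by
        have : Continuous fun s => sqd z (y s) :=
          hsc.comp (continuous_id.prodMk continuous_const)
        simp only [hF]
        fun_prop
      exact (hcont.tendsto t).mono_left nhdsWithin_le_nhds
    refine ge_of_tendsto h1 ?_
    have hc2 : Continuous fun s => sqd z (y s) := hsc.comp (continuous_id.prodMk continuous_const)
    have h2 : ∀ᶠ s in nhdsWithin t (Iio t), sqd z (y s) < R ^ 2 :=
      nhdsWithin_le_nhds ((hc2.tendsto t).eventually (gt_mem_nhds hz))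
    have h3 : ∀ᶠ s in nhdsWithin t (Iio t), 0 < s :=
      nhdsWithin_le_nhds (lt_mem_nhds ht0)
    filter_upwards [h2, h3, self_mem_nhdsWithin] with s hs2 hs3 hs4
    by_contra! hcon
    have hs4' : s < t := hs4
    have : t ≤ s := hmin (a := (s, z)) ⟨⟨⟨hs3.le, by linarith [ht.2]⟩, hs2.le⟩, hcon.le⟩
    linarith
  obtain ⟨hud, hpde, -⟩ := hu x (hyD t ht x hx)
  have hF0 : F (t, x) = 0 := le_antisymm hFx (hnear x hlt)
  have hsub : ContDiff ℝ 2 fun z => a + ε t * (1 - sqd z (y t) / R ^ 2) ^ 2 := by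
    have := contDiff_sqd (y t)
    fun_prop
  have hloc : IsLocalMin (fun z => u z - (a + ε t * (1 - sqd z (y t) / R ^ 2) ^ 2)) x := by
    have : {z | sqd z (y t) < R ^ 2} ∈ nhds x :=
      (isOpen_lt (contDiff_sqd (y t)).continuous continuous_const).mem_nhds hlt
    filter_upwards [this] with z hz
    have h1 := hnear z hz
    simp only [hF] at h1 hF0
    linarith
  have hlap := lap_nonneg_of_isLocalMin (hud.sub hsub.contDiffAt) hloc
  rw [lap_sub hud hsub.contDiffAt] at hlap
  obtain ⟨hε0, hε1, hε2⟩ := hε t ht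
  have hbump := lap_bump_add_ge hR hcR hε0 a (y t) x
  have hq0 : 0 ≤ sqd x (y t) / R ^ 2 := div_nonneg (sqd_nonneg _ _) hR2.le
  have hq1 : sqd x (y t) / R ^ 2 ≤ 1 := (div_le_one hR2).2 hx
  have hq : (1 - sqd x (y t) / R ^ 2) ^ 2 ≤ 1 := pow_le_one₀ (by linarith) (by linarith)
  have hff := hf (ε t * (1 - sqd x (y t) / R ^ 2) ^ 2) (by positivity)
    (le_trans (mul_le_of_le_one_right hε0.le hq) hε1)
  have hux : u x = a + ε t * (1 - sqd x (y t) / R ^ 2) ^ 2 := by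
    simp only [hF] at hF0
    linarith
  rw [hux] at hpde
  have h4 : c * e < 4 * ε t / R ^ 2 := by
    rw [lt_div_iff₀ hR2]
    exact hε2
  nlinarith

/-! ### Barriers in cylinders and strips -/

theorem cylinder_mem_nhds {N : ℕ} {i : Fin N} {c x : Fin N → ℝ} {L a b : ℝ}
    (h1 : rho i x c < L ^ 2) (h2 : a < x i) (h3 : x i < b) :
    {x | rho i x c ≤ L ^ 2 ∧ a ≤ x i ∧ x i ≤ b} ∈ nhds x := by
  have e1 : ∀ᶠ z in nhds x, rho i z c < L ^ 2 :=
    (contDiff_rho i c).continuous.continuousAt.eventually (gt_mem_nhds h1)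
  have e2 : ∀ᶠ z in nhds x, a < z i :=
    (continuous_apply i).continuousAt.eventually (lt_mem_nhds h2)
  have e3 : ∀ᶠ z in nhds x, z i < b :=
    (continuous_apply i).continuousAt.eventually (gt_mem_nhds h3)
  filter_upwards [e1, e2, e3] with z hz1 hz2 hz3 using ⟨hz1.le, hz2.le, hz3.le⟩

theorem le_of_odd_barrier {N : ℕ} {i : Fin N} {B F d : ℝ} (hB : 0 ≤ B) (hd : 0 < d)
    {w : (Fin N → ℝ) → ℝ} {x : Fin N → ℝ}
    (hw : ∀ z, rho i z x ≤ d ^ 2 → x i ≤ z i → z i ≤ x i + d →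
      ContDiffAt ℝ 2 w z ∧ w z ≤ B ∧ -(2 * F) ≤ lap w z)
    (hw0 : ∀ z, rho i z x ≤ d ^ 2 → z i = x i → w z ≤ 0) (hF : 0 ≤ F)
    {t : ℝ} (ht : 0 ≤ t) (htd : t ≤ d) :
    w (Function.update x i (x i + t)) ≤ 2 * d * (N * B / d ^ 2 + F + 1) * t := by
  set μ : ℝ := N * B / d ^ 2 + F + 1 with hμ
  have hd2 : 0 < d ^ 2 := by positivity
  have hN : (1 : ℝ) ≤ N := by
    exact_mod_cast Nat.one_le_iff_ne_zero.2 (by rintro rfl; exact i.elim0)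
  have hBd : 0 ≤ B / d ^ 2 := by positivity
  have hμB : B / d ^ 2 ≤ μ := by
    rw [hμ, mul_div_assoc]
    nlinarith
  have hμ0 : 0 ≤ μ := hBd.trans hμB
  set P : ℝ → ℝ := fun s => μ * (2 * d * (s - x i) - (s - x i) ^ 2) with hP
  set ψ : (Fin N → ℝ) → ℝ := fun z => P (z i) + (fun _ => B / d ^ 2) (z i) * rho i z x with hψ
  have hψd : ContDiff ℝ 2 ψ := by
    have := contDiff_rho i x
    simp only [hψ, hP]
    fun_prop
  have hlap : ∀ z, lap ψ z = -(2 * μ) + 2 * (N - 1) * (B / d ^ 2) := by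
    intro z
    have hb : ∀ s, HasDerivAt (fun s : ℝ => s - x i) 1 s := fun s =>
      (hasDerivAt_id s).sub_const _
    have := lap_cylindrical (P := P) (P' := fun s => μ * (2 * d - 2 * (s - x i)))
      (P'' := fun _ => -(2 * μ)) (Q := fun _ => B / d ^ 2) (Q' := fun _ => 0) (Q'' := fun _ => 0)
      (fun s => by
        have := (((hb s).const_mul (2 * d)).sub ((hb s).pow 2)).const_mul μ
        refine this.congr_deriv ?_
        push_cast
        simp) (fun s => by
        have := (((hb s).const_mul 2).const_sub (2 * d)).const_mul μ
        refine this.congr_deriv ?_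
        ring)
      (fun s => hasDerivAt_const s _) (fun s => hasDerivAt_const s _) i x z
    rw [hψ, this]
    ring
  have hmem : Function.update x i (x i + t) ∈
      {z | rho i z x ≤ d ^ 2 ∧ x i ≤ z i ∧ z i ≤ x i + d} := by
    refine ⟨?_, ?_, ?_⟩
    · rw [rho_update_self, rho_self]; positivity
    · simpa using ht
    · simpa using htd
  have key := nonneg_of_lap_neg (isCompact_cylinder i x d (x i) (x i + d))
    (w := fun z => ψ z - w z) (hψd.continuous.continuousOn.sub fun z hz =>
      (hw z hz.1 hz.2.1 hz.2.2).1.continuousAt.continuousWithinAt) ?_ _ hmem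
  · simp only [hψ, hP, rho_update_self, rho_self, Function.update_self] at key
    have : μ * (2 * d * (x i + t - x i) - (x i + t - x i) ^ 2) ≤ 2 * d * μ * t := by
      have : 0 ≤ μ * t ^ 2 := by positivity
      linarith
    linarith
  rintro z ⟨hz1, hz2, hz3⟩ hneg
  obtain ⟨hwd, hwB, hwl⟩ := hw z hz1 hz2 hz3
  have hr := rho_nonneg i z x
  have hquad : 0 ≤ 2 * d * (z i - x i) - (z i - x i) ^ 2 := by nlinarith
  have h1 : rho i z x < d ^ 2 := by
    refine lt_of_le_of_ne hz1 fun he => ?_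
    have e : B / d ^ 2 * d ^ 2 = B := by field_simp
    simp only [hψ, hP, he] at hneg
    have := mul_nonneg hμ0 hquad
    linarith
  have h2 : x i < z i := by
    refine lt_of_le_of_ne hz2 fun he => ?_
    have := hw0 z hz1 he.symm
    have h3 := mul_nonneg hμ0 hquad
    have h4 := mul_nonneg hBd hr
    simp only [hψ, hP] at hneg
    linarith
  have h3 : z i < x i + d := by
    refine lt_of_le_of_ne hz3 fun he => ?_
    have h4 := mul_nonneg hBd hr
    simp only [hψ, hP, he] at hneg
    have e : B / d ^ 2 * d ^ 2 = B := by field_simp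
    have h5 := mul_le_mul_of_nonneg_right hμB hd2.le
    nlinarith
  refine ⟨cylinder_mem_nhds h1 h2 h3, hψd.contDiffAt.sub hwd, ?_⟩
  rw [lap_sub hψd.contDiffAt hwd, hlap, hμ, mul_div_assoc]
  nlinarith

theorem abs_sub_le_of_lap_bounded {N : ℕ} {i : Fin N} {B F d : ℝ} (hB : 0 ≤ B) (hF : 0 ≤ F)
    (hd : 0 < d) {u : (Fin N → ℝ) → ℝ} {x : Fin N → ℝ}
    (hu : ∀ z, rho i z x ≤ d ^ 2 → |z i - x i| ≤ d →
      ContDiffAt ℝ 2 u z ∧ 0 ≤ u z ∧ u z ≤ B ∧ |lap u z| ≤ F)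
    {t : ℝ} (ht : 0 ≤ t) (htd : t ≤ d) :
    |u (Function.update x i (x i + t)) - u (Function.update x i (x i - t))|
      ≤ 2 * d * (N * B / d ^ 2 + F + 1) * t := by
  have hm : ∀ z, rho i z x ≤ d ^ 2 → x i ≤ z i → z i ≤ x i + d →
      rho i (mirror i (x i) z) x ≤ d ^ 2 ∧ |mirror i (x i) z i - x i| ≤ d ∧ |z i - x i| ≤ d := by
    intro z h1 h2 h3
    refine ⟨by rwa [mirror, rho_update_self], ?_, ?_⟩
    · simp only [mirror, Function.update_self]
      rw [abs_le]
      constructor <;> linarith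
    · rw [abs_le]
      constructor <;> linarith
  have hdm : ∀ z, ContDiffAt ℝ 2 u (mirror i (x i) z) →
      ContDiffAt ℝ 2 (fun y => u (mirror i (x i) y)) z := fun z h =>
    h.comp z (contDiff_mirror i (x i)).contDiffAt
  have em : mirror i (x i) (Function.update x i (x i + t)) = Function.update x i (x i - t) := by
    simp only [mirror, Function.update_self, Function.update_idem]
    congr 1
    ring
  have e0 : ∀ z : Fin N → ℝ, z i = x i → mirror i (x i) z = z := by
    intro z hz
    have : 2 * x i - z i = z i := by rw [hz]; ring
    rw [mirror, this, Function.update_eq_self]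
  rw [abs_le']
  constructor
  · have := le_of_odd_barrier (i := i) (w := fun z => u z - u (mirror i (x i) z)) (x := x) hB hd
      (F := F) (fun z h1 h2 h3 => ?_) (fun z _ h2 => by simp [e0 z h2]) hF ht htd
    · simpa only [em] using this
    · obtain ⟨k1, k2, k3⟩ := hm z h1 h2 h3
      obtain ⟨a1, a2, a3, a4⟩ := hu z h1 k3
      obtain ⟨b1, b2, b3, b4⟩ := hu _ k1 k2
      refine ⟨a1.sub (hdm z b1), by linarith, ?_⟩
      rw [lap_sub a1 (hdm z b1), lap_comp_mirror]
      linarith [(abs_le.1 a4).1, (abs_le.1 b4).2]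
  · have := le_of_odd_barrier (i := i) (w := fun z => u (mirror i (x i) z) - u z) (x := x) hB hd
      (F := F) (fun z h1 h2 h3 => ?_) (fun z _ h2 => by simp [e0 z h2]) hF ht htd
    · simpa only [em, neg_sub] using this
    · obtain ⟨k1, k2, k3⟩ := hm z h1 h2 h3
      obtain ⟨a1, a2, a3, a4⟩ := hu z h1 k3
      obtain ⟨b1, b2, b3, b4⟩ := hu _ k1 k2
      refine ⟨(hdm z b1).sub a1, by linarith, ?_⟩
      rw [lap_sub (hdm z b1) a1, lap_comp_mirror]
      linarith [(abs_le.1 a4).2, (abs_le.1 b4).1]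

theorem not_nonneg_of_narrow {K e β r g q s n W : ℝ} (hK : 0 ≤ K) (he : 0 < e) (hβ : 0 ≤ β)
    (hr : 0 ≤ r) (hs : 0 < s) (hg2 : g ≤ 2) (hq : K + 1 ≤ q) (hn : 1 ≤ n)
    (hβe : 4 * n * β < 2 * e) (hW : W ≤ K * (s * (g * (e + β * r))))
    (h : 0 ≤ W + (s * e * (-2 * q) + s * β * (-2 * q) * r + 2 * (n - 1) * (s * β * g))) :
    False := by
  have hp : 0 ≤ β * r := mul_nonneg hβ hr
  have hfactor : 0 ≤ s * ((e + β * r) * (K * g - 2 * q) + 2 * (n - 1) * (β * g)) := by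
    refine h.trans ?_
    linarith
  have hnn := nonneg_of_mul_nonneg_right hfactor hs
  have h1 : K * g - 2 * q ≤ -2 := by nlinarith
  have h2 : (e + β * r) * (K * g - 2 * q) ≤ (e + β * r) * (-2) :=
    mul_le_mul_of_nonneg_left h1 (by linarith)
  have h3 : β * g ≤ β * 2 := mul_le_mul_of_nonneg_left hg2 hβ
  have h4 : (n - 1) * (β * g) ≤ (n - 1) * (β * 2) := mul_le_mul_of_nonneg_left h3 (by linarith)
  nlinarith

theorem narrow_strip {N : ℕ} {i₀ i : Fin N} (hne : i₀ ≠ i) {K B l a b A : ℝ} (hK : 0 ≤ K)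
    (hB : 0 ≤ B) (hl : 0 < l) (hKl : (K + 1) * l ^ 2 ≤ 1) (hab : b - a ≤ l)
    {w : (Fin N → ℝ) → ℝ} (hwc : ContinuousOn w {x | A ≤ x i₀ ∧ a ≤ x i ∧ x i ≤ b})
    (hw : ∀ x : Fin N → ℝ, A < x i₀ → a < x i → x i < b →
      ContDiffAt ℝ 2 w x ∧ lap w x ≤ K * |w x|)
    (hwB : ∀ x : Fin N → ℝ, A ≤ x i₀ → a ≤ x i → x i ≤ b → -B ≤ w x)
    (hwa : ∀ x : Fin N → ℝ, A ≤ x i₀ → x i = a → 0 ≤ w x)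
    (hwb : ∀ x : Fin N → ℝ, A ≤ x i₀ → x i = b → 0 ≤ w x) {ε : ℝ} (hε : 0 < ε) :
    ∃ A', ∀ x : Fin N → ℝ, A' ≤ x i₀ → a ≤ x i → x i ≤ b → -ε ≤ w x := by
  set e := ε / 2 with he
  have he0 : 0 < e := by positivity
  set L : ℝ := 1 + 2 * N * B / e with hL
  have hq : 0 ≤ 2 * N * B / e := by positivity
  have hL1 : 1 ≤ L := by linarith
  have hL2 : 0 < L ^ 2 := by positivity
  have hLe : 4 * N * (B / L ^ 2) < 2 * e := by
    have h1 : 2 * N * B / e < L ^ 2 := by nlinarith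
    rw [div_lt_iff₀ he0] at h1
    rw [mul_div_assoc', div_lt_iff₀ hL2]
    linarith
  have hl2 : K + 1 ≤ 1 / l ^ 2 := by rwa [le_div_iff₀ (by positivity)]
  have hl2' : 0 < 1 / l ^ 2 := by positivity
  set β := B / L ^ 2 with hβ
  have hβ0 : 0 ≤ β := by positivity
  have hβL : β * L ^ 2 = B := by rw [hβ]; field_simp
  have hN : (1 : ℝ) ≤ N := by
    exact_mod_cast Nat.one_le_iff_ne_zero.2 (by rintro rfl; exact i.elim0)
  set g : ℝ → ℝ := fun s => 2 - (s - a) ^ 2 * (1 / l ^ 2) with hg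
  have hg1 : ∀ s, a ≤ s → s ≤ b → 1 ≤ g s ∧ g s ≤ 2 := by
    intro s h1 h2
    have h3 : (s - a) ^ 2 ≤ l ^ 2 := by nlinarith
    have h4 : (s - a) ^ 2 * (1 / l ^ 2) ≤ 1 := by
      rw [mul_one_div, div_le_one (by positivity)]
      exact h3
    have h5 : 0 ≤ (s - a) ^ 2 * (1 / l ^ 2) := by positivity
    simp only [hg]
    constructor <;> linarith
  refine ⟨A + L + 1, fun y hy hya hyb => ?_⟩
  by_contra! hwy
  set Φ : (Fin N → ℝ) → ℝ := fun z => g (z i) * (e + β * rho i z y) with hΦ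
  have hΦc : Continuous Φ := by
    have := (contDiff_rho i y).continuous
    simp only [hΦ, hg]
    fun_prop
  have hsub : {x | rho i x y ≤ L ^ 2 ∧ a ≤ x i ∧ x i ≤ b} ⊆ {x | A < x i₀ ∧ a ≤ x i ∧ x i ≤ b} := by
    rintro x ⟨h1, h2, h3⟩
    refine ⟨?_, h2, h3⟩
    have h4 := abs_le_of_sq_le_sq' ((sq_le_rho hne x y).trans h1) (by linarith)
    linarith [h4.1]
  have hΦpos : ∀ x ∈ {x | rho i x y ≤ L ^ 2 ∧ a ≤ x i ∧ x i ≤ b}, 0 < Φ x := by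
    rintro x ⟨h1, h2, h3⟩
    have := (hg1 _ h2 h3).1
    have hr := rho_nonneg i x y
    have : 0 < g (x i) := by linarith
    simp only [hΦ]
    positivity
  have hymem : y ∈ {x | rho i x y ≤ L ^ 2 ∧ a ≤ x i ∧ x i ≤ b} :=
    ⟨by rw [rho_self]; positivity, hya, hyb⟩
  have hcont : ContinuousOn (fun x => w x / Φ x) {x | rho i x y ≤ L ^ 2 ∧ a ≤ x i ∧ x i ≤ b} :=
    (hwc.mono fun x hx => ⟨(hsub hx).1.le, (hsub hx).2⟩).div hΦc.continuousOn
      fun x hx => (hΦpos x hx).ne'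
  obtain ⟨x, hx, hmin⟩ := (isCompact_cylinder i y L a b).exists_isMinOn ⟨y, hymem⟩ hcont
  have hxΦ := hΦpos x hx
  have hyΦ := hΦpos y hymem
  have hyΦε : Φ y ≤ ε := by
    have := (hg1 _ hya hyb).2
    simp only [hΦ, rho_self, mul_zero, add_zero]
    nlinarith
  set s := -(w x / Φ x) with hs
  have hs1 : 1 < s := by
    have h1 : w x / Φ x ≤ w y / Φ y := hmin hymem
    have h2 : w y / Φ y < -1 := by
      rw [div_lt_iff₀ hyΦ]
      linarith
    linarith
  have hwx : w x = -s * Φ x := by rw [hs]; field_simp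
  have hwx1 : w x < -Φ x := by nlinarith
  obtain ⟨hx1, hx2, hx3⟩ := hx
  have hxA := (hsub ⟨hx1, hx2, hx3⟩).1
  have hgx := hg1 _ hx2 hx3
  have hr := rho_nonneg i x y
  have hlt1 : rho i x y < L ^ 2 := by
    refine lt_of_le_of_ne hx1 fun hh => ?_
    have h1 := hwB x hxA.le hx2 hx3
    simp only [hΦ, hh, hβL] at hwx1
    nlinarith
  have hlt2 : a < x i := by
    refine lt_of_le_of_ne hx2 fun hh => ?_
    have := hwa x hxA.le hh.symm
    linarith
  have hlt3 : x i < b := by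
    refine lt_of_le_of_ne hx3 fun hh => ?_
    have := hwb x hxA.le hh
    linarith
  obtain ⟨hwd, hwl⟩ := hw x hxA hlt2 hlt3
  set Ψ : (Fin N → ℝ) → ℝ := fun z => (fun t => s * e * g t) (z i) +
    (fun t => s * β * g t) (z i) * rho i z y with hΨ
  have hΨΦ : ∀ z, Ψ z = s * Φ z := fun z => by simp only [hΨ, hΦ]; ring
  have hΨd : ContDiff ℝ 2 Ψ := by
    have := contDiff_rho i y
    simp only [hΨ, hg]
    fun_prop
  have hlapΨ : lap Ψ x = s * e * (-2 * (1 / l ^ 2)) + s * β * (-2 * (1 / l ^ 2)) * rho i x y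
      + 2 * (N - 1) * (s * β * g (x i)) := by
    have hb : ∀ t : ℝ, HasDerivAt g (-(2 * (t - a) * (1 / l ^ 2))) t := fun t => by
      have := (((((hasDerivAt_id t).sub_const a).pow 2).mul_const (1 / l ^ 2))).const_sub 2
      refine this.congr_deriv ?_
      push_cast
      simp
    have hb' : ∀ t : ℝ, HasDerivAt (fun t => -(2 * (t - a) * (1 / l ^ 2))) (-2 * (1 / l ^ 2)) t :=
      fun t => by
        have := ((((hasDerivAt_id t).sub_const a).const_mul 2).mul_const (1 / l ^ 2)).neg
        refine this.congr_deriv ?_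
        ring
    exact lap_cylindrical (fun t => (hb t).const_mul (s * e)) (fun t => (hb' t).const_mul (s * e))
      (fun t => (hb t).const_mul (s * β)) (fun t => (hb' t).const_mul (s * β)) i y x
  have hloc : IsLocalMin (fun z => w z + Ψ z) x := by
    filter_upwards [cylinder_mem_nhds hlt1 hlt2 hlt3] with z hz
    have h1 : w x / Φ x ≤ w z / Φ z := hmin hz
    rw [le_div_iff₀ (hΦpos z hz)] at h1
    rw [hΨΦ, hΨΦ, hwx]
    have h2 : w x / Φ x = -s := by rw [hs]; ring
    rw [h2] at h1
    linarith
  have hfin := lap_nonneg_of_isLocalMin (hwd.add hΨd.contDiffAt) hloc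
  rw [lap_add hwd hΨd.contDiffAt, hlapΨ] at hfin
  have habs : |w x| = s * Φ x := by
    rw [abs_of_neg (by linarith), hwx]
    ring
  rw [habs] at hwl
  exact not_nonneg_of_narrow hK he0 hβ0 hr (by linarith) hgx.2 hl2 hN (by linarith) hwl hfin

theorem strip_lower_bound {N : ℕ} {i₀ i : Fin N} (hne : i₀ ≠ i) {K a b A η e : ℝ} (hK : 0 ≤ K)
    (hη : 0 < η) (he : 0 ≤ e) (hKe : 4 * K * e ≤ η)
    {w : (Fin N → ℝ) → ℝ} (hwc : ContinuousOn w {x | A ≤ x i₀ ∧ a ≤ x i ∧ x i ≤ b})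
    (hw : ∀ x : Fin N → ℝ, A < x i₀ → a < x i → x i < b →
      ContDiffAt ℝ 2 w x ∧ lap w x ≤ K * |w x|)
    (hwe : ∀ x : Fin N → ℝ, A ≤ x i₀ → a ≤ x i → x i ≤ b → -e ≤ w x)
    (hwa : ∀ x : Fin N → ℝ, A ≤ x i₀ → x i = a →
      η * (Real.exp (√(K + 1) * (b - a)) - 1) ≤ w x) :
    ∃ A', ∀ x : Fin N → ℝ, A' ≤ x i₀ → a ≤ x i → x i ≤ b →
      η * (Real.exp (√(K + 1) * (b - x i)) - 1) - e ≤ w x := by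
  set k := √(K + 1) with hk
  have hk2 : k * k = K + 1 := Real.mul_self_sqrt (by linarith)
  have hk0 : 0 ≤ k := Real.sqrt_nonneg _
  set G : ℝ → ℝ := fun s => η * (Real.exp (k * (b - s)) - 1) with hG
  have hGb : G b = 0 := by simp [hG]
  have hGanti : ∀ s t, s ≤ t → G t ≤ G s := by
    intro s t hst
    simp only [hG]
    gcongr
  by_cases hab : b < a
  · exact ⟨A, fun x _ h1 h2 => by linarith⟩
  push Not at hab
  have hGa : 0 ≤ G a := hGb ▸ hGanti a b hab
  set L : ℝ := 1 + 4 * N * G a / η with hL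
  have hq : 0 ≤ 4 * N * G a / η := by positivity
  have hL1 : 1 ≤ L := by linarith
  have hL2 : 0 < L ^ 2 := by positivity
  set β := G a / L ^ 2 with hβ
  have hβ0 : 0 ≤ β := by positivity
  have hβL : β * L ^ 2 = G a := by rw [hβ]; field_simp
  have hLe : 4 * N * β < η := by
    have h1 : 4 * N * G a / η < L ^ 2 := by nlinarith
    rw [div_lt_iff₀ hη] at h1
    rw [hβ, mul_div_assoc', div_lt_iff₀ hL2]
    linarith
  refine ⟨A + L + 1, fun y hy hya hyb => ?_⟩
  have hsub : {x | rho i x y ≤ L ^ 2 ∧ a ≤ x i ∧ x i ≤ b} ⊆ {x | A < x i₀ ∧ a ≤ x i ∧ x i ≤ b} := by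
    rintro x ⟨h1, h2, h3⟩
    refine ⟨?_, h2, h3⟩
    have h4 := abs_le_of_sq_le_sq' ((sq_le_rho hne x y).trans h1) (by linarith)
    linarith [h4.1]
  have hymem : y ∈ {x | rho i x y ≤ L ^ 2 ∧ a ≤ x i ∧ x i ≤ b} :=
    ⟨by rw [rho_self]; positivity, hya, hyb⟩
  set ψ : (Fin N → ℝ) → ℝ := fun z => (fun t => G t - e) (z i) + (fun _ => -β) (z i) * rho i z y
    with hψ
  have hψd : ContDiff ℝ 2 ψ := by
    have := contDiff_rho i y
    simp only [hψ, hG]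
    fun_prop
  have hlap : ∀ z, lap ψ z = (K + 1) * (G (z i) + η) - 2 * (N - 1) * β := by
    intro z
    have hb : ∀ t : ℝ, HasDerivAt (fun t => k * (b - t)) (-k) t := fun t => by
      simpa using ((hasDerivAt_id t).const_sub b).const_mul k
    have := lap_cylindrical (P := fun t => G t - e)
      (P' := fun t => η * (Real.exp (k * (b - t)) * -k))
      (P'' := fun t => η * (Real.exp (k * (b - t)) * -k * -k)) (Q := fun _ => -β)
      (Q' := fun _ => 0) (Q'' := fun _ => 0)
      (fun t => ((((hb t).exp).sub_const 1).const_mul η).sub_const e)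
      (fun t => ((((hb t).exp).mul_const (-k))).const_mul η)
      (fun s => hasDerivAt_const s _) (fun s => hasDerivAt_const s _) i y z
    rw [hψ, this, ← hk2]
    simp only [hG]
    ring
  have key := nonneg_of_lap_neg (isCompact_cylinder i y L a b) (w := fun z => w z - ψ z)
    ((hwc.mono fun x hx => ⟨(hsub hx).1.le, (hsub hx).2⟩).sub hψd.continuous.continuousOn)
    ?_ y hymem
  · simp only [hψ, rho_self] at key
    linarith
  rintro x hx hneg
  have hxA := (hsub hx).1
  obtain ⟨hx1, hx2, hx3⟩ := hx
  have hr := rho_nonneg i x y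
  have hβr := mul_nonneg hβ0 hr
  have hwx := hwe x hxA.le hx2 hx3
  have hGx := hGanti _ _ hx2
  have hGx0 : 0 ≤ G (x i) := hGb ▸ hGanti _ _ hx3
  have hbad : w x < G (x i) - e - β * rho i x y := by
    simp only [hψ] at hneg
    linarith
  have hlt1 : rho i x y < L ^ 2 := by
    refine lt_of_le_of_ne hx1 fun hh => ?_
    rw [hh, hβL] at hbad
    linarith
  have hlt2 : a < x i := by
    refine lt_of_le_of_ne hx2 fun hh => ?_
    have := hwa x hxA.le hh.symm
    rw [← hh] at hbad
    simp only [hG] at hbad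
    linarith
  have hlt3 : x i < b := by
    refine lt_of_le_of_ne hx3 fun hh => ?_
    rw [hh, hGb] at hbad
    linarith
  obtain ⟨hwd, hwl⟩ := hw x hxA hlt2 hlt3
  refine ⟨cylinder_mem_nhds hlt1 hlt2 hlt3, hwd.sub hψd.contDiffAt, ?_⟩
  rw [lap_sub hwd hψd.contDiffAt, hlap]
  have habs : |w x| ≤ G (x i) + 2 * e := by
    rw [abs_le]
    constructor <;> linarith
  have := mul_le_mul_of_nonneg_left habs hK
  have hN : (0 : ℝ) ≤ N := Nat.cast_nonneg N
  nlinarith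

/-! ### Positive solutions in the quarter-space -/

theorem abs_sub_le_of_sqd_le {N : ℕ} {x c : Fin N → ℝ} {R : ℝ} (hR : 0 ≤ R)
    (h : sqd x c ≤ R ^ 2) (j : Fin N) : |x j - c j| ≤ R :=
  abs_le_of_sq_le_sq ((sq_le_sqd j x c).trans h) hR

theorem sqd_comm {N : ℕ} (x c : Fin N → ℝ) : sqd x c = sqd c x :=
  Finset.sum_congr rfl fun _ _ => by ring

theorem exists_sqd_le_imp {N : ℕ} {c : Fin N → ℝ} {s : Set (Fin N → ℝ)} (hs : s ∈ nhds c) :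
    ∃ ρ > 0, ∀ x, sqd x c ≤ ρ ^ 2 → x ∈ s := by
  obtain ⟨δ, hδ, hδs⟩ := Metric.mem_nhds_iff.1 hs
  refine ⟨δ / 2, by positivity, fun x hx => hδs ?_⟩
  rw [Metric.mem_ball, dist_pi_lt_iff hδ]
  intro j
  rw [Real.dist_eq]
  linarith [abs_sub_le_of_sqd_le (by positivity) hx j]

theorem sqd_lt_mem_nhds {N : ℕ} {x c : Fin N → ℝ} {r : ℝ} (h : sqd x c < r) :
    ∀ᶠ z in nhds x, sqd z c < r :=
  (contDiff_sqd c).continuous.continuousAt.eventually (gt_mem_nhds h)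

theorem pos_of_lap_nonpos {N : ℕ} {U : Set (Fin N → ℝ)} (hU : IsOpen U) (hUc : IsPreconnected U)
    {u : (Fin N → ℝ) → ℝ} (hu : ∀ x ∈ U, ContDiffAt ℝ 2 u x ∧ lap u x ≤ 0 ∧ 0 ≤ u x)
    (hpos : ∃ x ∈ U, 0 < u x) : ∀ x ∈ U, 0 < u x := by
  have hcU : ContinuousOn u U := fun x hx => (hu x hx).1.continuousAt.continuousWithinAt
  have hV : IsOpen {x | x ∈ U ∧ 0 < u x} := hcU.isOpen_inter_preimage hU isOpen_Ioi
  obtain ⟨x₀, hx₀, hx₀p⟩ := hpos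
  have := hUc.subset_of_closure_inter_subset hV ⟨x₀, hx₀, hx₀, hx₀p⟩ ?_
  · exact fun x hx => (this hx).2
  rintro q ⟨hq, hqU⟩
  refine ⟨hqU, ?_⟩
  obtain ⟨δ, hδ, hδU⟩ := Metric.mem_nhds_iff.1 (hU.mem_nhds hqU)
  have hr : 0 < δ / 3 := by positivity
  obtain ⟨c, hc, hcU', hcp⟩ := mem_closure_iff_nhds.1 hq _
    (sqd_lt_mem_nhds (x := q) (c := q) (r := (δ / 3) ^ 2) (by rw [sqd_self]; positivity))
  have hc' : sqd c q < (δ / 3) ^ 2 := hc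
  have hball : ∀ x, sqd x c ≤ (δ / 3) ^ 2 → x ∈ U := by
    intro x hx
    refine hδU ?_
    rw [Metric.mem_ball, dist_pi_lt_iff hδ]
    intro j
    rw [Real.dist_eq]
    have h1 := abs_sub_le_of_sqd_le hr.le hx j
    have h2 := abs_sub_le_of_sqd_le hr.le hc'.le j
    have h3 := abs_sub_le (x j) (c j) (q j)
    linarith
  obtain ⟨ρ, hρ, hρu⟩ := exists_sqd_le_imp (c := c) (s := {x | u c / 2 < u x})
    ((hu c hcU').1.continuousAt.eventually (lt_mem_nhds (by linarith)))
  obtain ⟨k, hk⟩ := exists_superharmonic_spread N hρ hr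
  have hfin := hk u c (u c / 2) (by positivity) (fun x hx =>
    (hu x (hball x hx)).1.continuousAt.continuousWithinAt)
    (fun x hx => ⟨(hu x (hball x hx.le)).1, (hu x (hball x hx.le)).2.1⟩)
    (fun x hx => (hu x (hball x hx)).2.2) (fun x hx _ => le_of_lt (hρu x hx)) q
    (by rw [sqd_comm]; exact hc'.le)
  refine lt_of_lt_of_le ?_ hfin
  have : 0 < (δ / 3) ^ 2 - sqd q c := by rw [sqd_comm]; linarith
  positivity

/-- A positive bounded solution of `Δu + f(u) = 0` in the quarter-space `x i₀ > 0`, `x i > 0`,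
vanishing on the face `x i = 0`, together with the quantitative bounds on `f` that are used. -/
structure QuarterSolution {N : ℕ} (i₀ i : Fin N) (f : ℝ → ℝ) (u : (Fin N → ℝ) → ℝ)
    (B K F : ℝ) : Prop where
  ne : i₀ ≠ i
  B_nonneg : 0 ≤ B
  K_nonneg : 0 ≤ K
  F_nonneg : 0 ≤ F
  f_nonneg : ∀ s, 0 ≤ s → 0 ≤ f s
  f_lip : ∀ s t, 0 ≤ s → s ≤ B → 0 ≤ t → t ≤ B → |f s - f t| ≤ K * |s - t|
  f_le : ∀ s, 0 ≤ s → s ≤ B → f s ≤ F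
  f_growth : ∀ m, 0 ≤ m → ∃ c > 0, ∃ s₀ > 0, ∀ s, 0 ≤ s → s ≤ s₀ → c * s ≤ f (m + s)
  cont : ContinuousOn u {x | 0 < x i₀ ∧ 0 ≤ x i}
  smooth : ∀ x : Fin N → ℝ, 0 < x i₀ → 0 < x i → ContDiffAt ℝ 2 u x
  pde : ∀ x : Fin N → ℝ, 0 < x i₀ → 0 < x i → lap u x + f (u x) = 0
  bot : ∀ x : Fin N → ℝ, 0 < x i₀ → x i = 0 → u x = 0
  nonneg : ∀ x : Fin N → ℝ, 0 < x i₀ → 0 ≤ x i → 0 ≤ u x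
  le : ∀ x : Fin N → ℝ, 0 < x i₀ → 0 ≤ x i → u x ≤ B
  pos : ∀ x : Fin N → ℝ, 0 < x i₀ → 0 < x i → 0 < u x

namespace QuarterSolution

variable {N : ℕ} {i₀ i : Fin N} {f : ℝ → ℝ} {u : (Fin N → ℝ) → ℝ} {B K F : ℝ}

theorem abs_lap_le (h : QuarterSolution i₀ i f u B K F) {x : Fin N → ℝ} (h0 : 0 < x i₀)
    (h1 : 0 < x i) : |lap u x| ≤ F := by
  have e : lap u x = -f (u x) := by linarith [h.pde x h0 h1]
  have hn := h.nonneg x h0 h1.le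
  rw [e, abs_neg, abs_of_nonneg (h.f_nonneg _ hn)]
  exact h.f_le _ hn (h.le x h0 h1.le)

theorem lap_nonpos (h : QuarterSolution i₀ i f u B K F) {x : Fin N → ℝ} (h0 : 0 < x i₀)
    (h1 : 0 < x i) : lap u x ≤ 0 := by
  linarith [h.pde x h0 h1, h.f_nonneg _ (h.nonneg x h0 h1.le)]

theorem pos_of_sqd_le {y x : Fin N → ℝ} {R : ℝ} (hR : 0 ≤ R) {j : Fin N} (hy : R < y j)
    (hx : sqd x y ≤ R ^ 2) : 0 < x j := by
  linarith [(abs_le.1 (abs_sub_le_of_sqd_le hR hx j)).1]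

theorem exists_bump_lt (h : QuarterSolution i₀ i f u B K F) :
    ∃ R > 0, ∃ ε > 0, ∀ y : Fin N → ℝ, R < y i₀ → R < y i → ∀ x, sqd x y ≤ R ^ 2 →
      ε * (1 - sqd x y / R ^ 2) ^ 2 < u x := by
  obtain ⟨c, hc, ε, hε, hf⟩ := h.f_growth 0 le_rfl
  have hN : (0 : ℝ) ≤ N := Nat.cast_nonneg N
  set R : ℝ := (N + 2) / √c with hR
  have hsc : 0 < √c := Real.sqrt_pos.2 hc
  have hR0 : 0 < R := by positivity
  have hcR : c * R ^ 2 = (N + 2) ^ 2 := by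
    rw [hR, div_pow, Real.sq_sqrt hc.le]
    field_simp
  refine ⟨R, hR0, ε, hε, fun y hy0 hy1 => ?_⟩
  have hD : ∀ x, sqd x y ≤ R ^ 2 → 0 < x i₀ ∧ 0 < x i := fun x hx =>
    ⟨pos_of_sqd_le hR0.le hy0 hx, pos_of_sqd_le hR0.le hy1 hx⟩
  obtain ⟨z, hz, hmin⟩ := (isCompact_sqd_le y R).exists_isMinOn (f := u)
    ⟨y, by change sqd y y ≤ R ^ 2; rw [sqd_self]; positivity⟩ fun x hx =>
      (h.smooth x (hD x hx).1 (hD x hx).2).continuousAt.continuousWithinAt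
  have huz := h.pos z (hD z hz).1 (hD z hz).2
  set δ := min (u z / 2) ε with hδ
  have hδ0 : 0 < δ := lt_min (by positivity) hε
  have hδ1 : δ ≤ u z / 2 := min_le_left _ _
  have hδ2 : δ ≤ ε := min_le_right _ _
  have key := bump_lt_of_homotopy (f := f) (u := u) (D := {x | sqd x y ≤ R ^ 2}) (a := 0) (c := c)
    (e := 0) (R := R) (ε₁ := ε) (fun x hx => ⟨h.smooth x (hD x hx).1 (hD x hx).2,
      h.pde x (hD x hx).1 (hD x hx).2, h.pos x (hD x hx).1 (hD x hx).2⟩)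
    (fun s h1 h2 => by simpa using hf s h1 h2) hR0 hcR (ε := fun t => δ + t * (ε - δ))
    (y := fun _ => y) (by fun_prop) continuous_const ?_ (fun _ _ x hx => hx) ?_
  · intro x hx
    have := key x hx
    simpa using this
  · rintro t ⟨ht0, ht1⟩
    have h1 : 0 ≤ t * (ε - δ) := mul_nonneg ht0 (by linarith)
    have h2 : t * (ε - δ) ≤ 1 * (ε - δ) := mul_le_mul_of_nonneg_right ht1 (by linarith)
    refine ⟨by linarith, by linarith, by linarith⟩
  · intro x hx
    have hux : u z ≤ u x := hmin hx
    have h1 : 0 ≤ sqd x y / R ^ 2 := div_nonneg (sqd_nonneg _ _) (by positivity)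
    have h2 : sqd x y / R ^ 2 ≤ 1 := (div_le_one (by positivity)).2 hx
    have h3 : (1 - sqd x y / R ^ 2) ^ 2 ≤ 1 := pow_le_one₀ (by linarith) (by linarith)
    have h4 : δ * (1 - sqd x y / R ^ 2) ^ 2 ≤ δ * 1 := mul_le_mul_of_nonneg_left h3 hδ0.le
    simp only [zero_mul, add_zero, zero_add]
    linarith

theorem exists_lower_bound (h : QuarterSolution i₀ i f u B K F) {H : ℝ} (hH : 0 < H) :
    ∃ ε > 0, ∃ A, ∀ x : Fin N → ℝ, A ≤ x i₀ → H ≤ x i → ε ≤ u x := by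
  obtain ⟨R, hR, ε, hε, hb⟩ := h.exists_bump_lt
  set τ := R - min H R / 2 with hτ
  have h1 : 0 < min H R := lt_min hH hR
  have h2 : min H R ≤ H := min_le_left _ _
  have h3 : min H R ≤ R := min_le_right _ _
  have hτ0 : 0 < τ := by linarith
  have hτR : τ ^ 2 < R ^ 2 := by nlinarith
  have hq : 0 < 1 - τ ^ 2 / R ^ 2 := by
    rw [sub_pos, div_lt_one (by positivity)]
    exact hτR
  refine ⟨ε * (1 - τ ^ 2 / R ^ 2) ^ 2, by positivity, R + 1, fun x hx0 hx1 => ?_⟩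
  have hs : sqd x (Function.update x i (x i + τ)) = τ ^ 2 := by
    rw [sqd_comm, sqd_update, rho_self]
    ring
  have := hb (Function.update x i (x i + τ)) (by
    rw [Function.update_of_ne h.ne]; linarith) (by
    rw [Function.update_self]; linarith) x (by rw [hs]; exact hτR.le)
  rw [hs] at this
  exact this.le

end QuarterSolution

/-! ### Moving planes near infinity -/

theorem mirror_apply_self {N : ℕ} (i : Fin N) (l : ℝ) (x : Fin N → ℝ) :
    mirror i l x i = 2 * l - x i := by
  simp [mirror]

theorem mirror_apply_of_ne {N : ℕ} {i j : Fin N} (h : j ≠ i) (l : ℝ) (x : Fin N → ℝ) :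
    mirror i l x j = x j := by
  simp [mirror, h]

theorem mirror_eq_self {N : ℕ} {i : Fin N} {l : ℝ} {x : Fin N → ℝ} (h : x i = l) :
    mirror i l x = x := by
  have : 2 * l - x i = x i := by rw [h]; ring
  rw [mirror, this, Function.update_eq_self]

/-- Far out in the direction `i₀`, reflecting a point with `0 ≤ x i ≤ l` across the hyperplane
`x i = l` does not decrease `u`, up to an arbitrarily small error. -/
def IncreasesUnderMirror {N : ℕ} (i₀ i : Fin N) (u : (Fin N → ℝ) → ℝ) (l : ℝ) : Prop :=
  ∀ ε > 0, ∃ A, ∀ x : Fin N → ℝ, A ≤ x i₀ → 0 ≤ x i → x i ≤ l → -ε ≤ u (mirror i l x) - u x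

namespace QuarterSolution

variable {N : ℕ} {i₀ i : Fin N} {f : ℝ → ℝ} {u : (Fin N → ℝ) → ℝ} {B K F : ℝ}

theorem mirror_sub_lap_le (h : QuarterSolution i₀ i f u B K F) {l : ℝ} {x : Fin N → ℝ}
    (h0 : 0 < x i₀) (h1 : 0 < x i) (h2 : x i < 2 * l) :
    ContDiffAt ℝ 2 (fun y => u (mirror i l y) - u y) x ∧
      lap (fun y => u (mirror i l y) - u y) x ≤ K * |u (mirror i l x) - u x| := by
  have m0 : 0 < mirror i l x i₀ := by rwa [mirror_apply_of_ne h.ne]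
  have m1 : 0 < mirror i l x i := by rw [mirror_apply_self]; linarith
  have hm : ContDiffAt ℝ 2 (fun y => u (mirror i l y)) x :=
    (h.smooth _ m0 m1).comp x (contDiff_mirror i l).contDiffAt
  have hx := h.smooth x h0 h1
  refine ⟨hm.sub hx, ?_⟩
  rw [lap_sub hm hx, lap_comp_mirror]
  have := h.f_lip _ _ (h.nonneg x h0 h1.le) (h.le x h0 h1.le) (h.nonneg _ m0 m1.le)
    (h.le _ m0 m1.le)
  rw [abs_sub_comm (u x)] at this
  have h3 := le_abs_self (f (u x) - f (u (mirror i l x)))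
  linarith [h.pde x h0 h1, h.pde _ m0 m1]

theorem continuousOn_mirror_sub (h : QuarterSolution i₀ i f u B K F) (l : ℝ) :
    ContinuousOn (fun y => u (mirror i l y) - u y) {x | 0 < x i₀ ∧ 0 ≤ x i ∧ x i ≤ 2 * l} := by
  refine ContinuousOn.sub ?_ (h.cont.mono fun x hx => ⟨hx.1, hx.2.1⟩)
  refine h.cont.comp (contDiff_mirror i l).continuous.continuousOn fun x hx => ?_
  refine ⟨?_, ?_⟩
  · rw [mirror_apply_of_ne h.ne]
    exact hx.1
  · rw [mirror_apply_self]
    linarith [hx.2.2]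

theorem neg_le_mirror_sub (h : QuarterSolution i₀ i f u B K F) {l : ℝ} {x : Fin N → ℝ}
    (h0 : 0 < x i₀) (h1 : 0 ≤ x i) (h2 : x i ≤ 2 * l) : -B ≤ u (mirror i l x) - u x := by
  have := h.nonneg (mirror i l x) (by rwa [mirror_apply_of_ne h.ne])
    (by rw [mirror_apply_self]; linarith)
  linarith [h.le x h0 h1]

theorem neg_le_mirror_sub_of_narrow (h : QuarterSolution i₀ i f u B K F) {ℓ l a A : ℝ}
    (hℓ : 0 < ℓ) (hK : (K + 1) * ℓ ^ 2 ≤ 1) (ha : 0 ≤ a) (hl : 0 ≤ l) (hal : l - a ≤ ℓ)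
    (hA : 0 < A)
    (hwa : ∀ x : Fin N → ℝ, A ≤ x i₀ → x i = a → 0 ≤ u (mirror i l x) - u x) {ε : ℝ}
    (hε : 0 < ε) :
    ∃ A', ∀ x : Fin N → ℝ, A' ≤ x i₀ → a ≤ x i → x i ≤ l → -ε ≤ u (mirror i l x) - u x := by
  refine narrow_strip h.ne h.K_nonneg h.B_nonneg hℓ hK hal
    (w := fun y => u (mirror i l y) - u y) (A := A) ?_ ?_ ?_ hwa ?_ hε
  · exact (h.continuousOn_mirror_sub l).mono fun x hx =>
      ⟨hA.trans_le hx.1, ha.trans hx.2.1, hx.2.2.trans (by linarith)⟩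
  · intro x h1 h2 h3
    exact h.mirror_sub_lap_le (by linarith) (by linarith) (by linarith)
  · intro x h1 h2 h3
    exact h.neg_le_mirror_sub (by linarith) (by linarith) (by linarith)
  · intro x _ h2
    simp only [mirror_eq_self h2, sub_self, le_refl]

theorem increasesUnderMirror_of_narrow (h : QuarterSolution i₀ i f u B K F) {ℓ : ℝ}
    (hℓ : 0 < ℓ) (hK : (K + 1) * ℓ ^ 2 ≤ 1) : IncreasesUnderMirror i₀ i u ℓ := by
  intro ε hε
  refine h.neg_le_mirror_sub_of_narrow hℓ hK le_rfl hℓ.le (by linarith) one_pos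
    (fun x h0 h1 => ?_) hε
  rw [h.bot x (by linarith) h1, sub_zero]
  exact h.nonneg _ (by rw [mirror_apply_of_ne h.ne]; linarith)
    (by rw [mirror_apply_self, h1]; linarith)

theorem abs_sub_update_le (h : QuarterSolution i₀ i f u B K F) {d : ℝ} (hd : 0 < d) (j : Fin N)
    {x : Fin N → ℝ} (h0 : d < x i₀) (h1 : d < x i) {t : ℝ} (ht : 0 ≤ t) (htd : t ≤ d) :
    |u (Function.update x j (x j + t)) - u (Function.update x j (x j - t))|
      ≤ 2 * d * (N * B / d ^ 2 + F + 1) * t := by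
  refine abs_sub_le_of_lap_bounded h.B_nonneg h.F_nonneg hd (fun z hz hzj => ?_) ht htd
  have key : ∀ k, |z k - x k| ≤ d := by
    intro k
    by_cases hk : k = j
    · rwa [hk]
    · exact abs_le_of_sq_le_sq ((sq_le_rho hk z x).trans hz) hd.le
  have k0 : 0 < z i₀ := by linarith [(abs_le.1 (key i₀)).1]
  have k1 : 0 < z i := by linarith [(abs_le.1 (key i)).1]
  exact ⟨h.smooth z k0 k1, h.nonneg z k0 k1.le, h.le z k0 k1.le, h.abs_lap_le k0 k1⟩

theorem exists_mirror_step (h : QuarterSolution i₀ i f u B K F) {ℓ : ℝ} (hℓ : 0 < ℓ)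
    (hK : (K + 1) * ℓ ^ 2 ≤ 1) (Λ : ℝ) :
    ∃ δ₀ > 0, ∀ l, ℓ ≤ l → l ≤ Λ → IncreasesUnderMirror i₀ i u l → ∀ δ, 0 ≤ δ → δ ≤ δ₀ →
      IncreasesUnderMirror i₀ i u (l + δ) := by
  obtain ⟨ε, hε, A₀, hA₀⟩ := h.exists_lower_bound (H := 2 * ℓ) (by linarith)
  have hK0 := h.K_nonneg
  have hB0 := h.B_nonneg
  have hF0 := h.F_nonneg
  have hk1 : 1 ≤ √(K + 1) := Real.one_le_sqrt.2 (by linarith)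
  set k := √(K + 1) with hk
  set η := ε / Real.exp (k * Λ) with hη
  have hη0 : 0 < η := by positivity
  set σ := ℓ / 2 with hσ
  have hσ0 : 0 < σ := by positivity
  set e := min (η / (4 * (K + 1))) (η * σ / 2) with he
  have he0 : 0 < e := by positivity
  have he1 : 4 * K * e ≤ η := by
    have h1 : e ≤ η / (4 * (K + 1)) := min_le_left _ _
    rw [le_div_iff₀ (by positivity)] at h1
    linarith
  have he2 : e ≤ η * σ / 2 := min_le_right _ _
  set C := 2 * σ * (N * B / σ ^ 2 + F + 1) with hC
  have hC0 : 0 < C := by positivity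
  refine ⟨min σ (η * σ / 2 / C), by positivity, fun l hl1 hl2 hP δ hδ0 hδ1 => ?_⟩
  have hδσ : δ ≤ σ := hδ1.trans (min_le_left _ _)
  have hδC : δ * C ≤ η * σ / 2 := (le_div_iff₀ hC0).1 (hδ1.trans (min_le_right _ _))
  obtain ⟨A₁, hA₁⟩ := hP e he0
  set A₂ := max (max A₀ A₁) (1 + σ) with hA₂
  have a0 : A₀ ≤ A₂ := (le_max_left _ _).trans (le_max_left _ _)
  have a1 : A₁ ≤ A₂ := (le_max_right _ _).trans (le_max_left _ _)
  have a2 : 1 + σ ≤ A₂ := le_max_right _ _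
  obtain ⟨A₃, hA₃⟩ := strip_lower_bound h.ne h.K_nonneg hη0 he0.le he1 (a := 0) (b := l)
    (w := fun y => u (mirror i l y) - u y) (A := A₂)
    ((h.continuousOn_mirror_sub l).mono fun x hx =>
      ⟨by linarith [hx.1], hx.2.1, hx.2.2.trans (by linarith)⟩)
    (fun x h1 h2 h3 => h.mirror_sub_lap_le (by linarith) h2 (by linarith))
    (fun x h1 h2 h3 => hA₁ x (by linarith) h2 h3)
    (fun x h1 h2 => by
      have e0 := h.bot x (by linarith) h2
      have e4 := hA₀ (mirror i l x) (by rw [mirror_apply_of_ne h.ne]; linarith)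
        (by rw [mirror_apply_self, h2]; linarith)
      have e1 : Real.exp (k * (l - 0)) ≤ Real.exp (k * Λ) := by
        rw [sub_zero]
        gcongr
      have e2 : η * Real.exp (k * Λ) = ε := by rw [hη]; field_simp
      have e3 : η * Real.exp (k * (l - 0)) ≤ η * Real.exp (k * Λ) :=
        mul_le_mul_of_nonneg_left e1 hη0.le
      simp only [e0, sub_zero] at e3 ⊢
      linarith)
  have hlow : ∀ x : Fin N → ℝ, max A₂ A₃ ≤ x i₀ → 0 ≤ x i → x i ≤ l - σ →
      0 ≤ u (mirror i (l + δ) x) - u x := by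
    intro x hx0 hx1 hx2
    have b0 : A₂ ≤ x i₀ := (le_max_left _ _).trans hx0
    have h1 := hA₃ x ((le_max_right _ _).trans hx0) hx1 (by linarith)
    have h2 : σ ≤ Real.exp (k * (l - x i)) - 1 := by
      have e1 := Real.add_one_le_exp (k * (l - x i))
      have e2 : 1 * σ ≤ k * (l - x i) := mul_le_mul hk1 (by linarith) hσ0.le (by linarith)
      linarith
    have h3 : η * σ ≤ η * (Real.exp (k * (l - x i)) - 1) := mul_le_mul_of_nonneg_left h2 hη0.le
    set y := Function.update x i (2 * l - x i + δ) with hy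
    have h4 := h.abs_sub_update_le hσ0 i (x := y) (by
      rw [hy, Function.update_of_ne h.ne]; linarith) (by
      rw [hy, Function.update_self]; linarith) hδ0 hδσ
    have e1 : Function.update y i (y i + δ) = mirror i (l + δ) x := by
      simp only [hy, mirror, Function.update_self, Function.update_idem]
      congr 1
      ring
    have e2 : Function.update y i (y i - δ) = mirror i l x := by
      simp only [hy, mirror, Function.update_self, Function.update_idem]
      congr 1
      ring
    rw [e1, e2] at h4
    have h5 := (abs_le.1 h4).1
    linarith
  intro ε' hε'
  obtain ⟨A₄, hA₄⟩ := h.neg_le_mirror_sub_of_narrow hℓ hK (a := l - σ) (l := l + δ)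
    (A := max A₂ A₃) (by linarith) (by linarith) (by linarith)
    (by linarith [le_max_left A₂ A₃])
    (fun x h1 h2 => hlow x h1 (by rw [h2]; linarith) h2.le) hε'
  refine ⟨max (max A₂ A₃) A₄, fun x h1 h2 h3 => ?_⟩
  rcases le_total (x i) (l - σ) with h4 | h4
  · linarith [hlow x ((le_max_left _ _).trans h1) h2 h4]
  · exact hA₄ x ((le_max_right _ _).trans h1) h4 h3

theorem exists_increasesUnderMirror (h : QuarterSolution i₀ i f u B K F) :
    ∃ ℓ, ∀ Λ, ℓ ≤ Λ → IncreasesUnderMirror i₀ i u Λ := by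
  have hK0 := h.K_nonneg
  have hℓ : 0 < 1 / (K + 1) := by positivity
  have hK : (K + 1) * (1 / (K + 1)) ^ 2 ≤ 1 := by
    have e : (K + 1) * (1 / (K + 1)) ^ 2 = 1 / (K + 1) := by field_simp
    rw [e, div_le_one (by positivity)]
    linarith
  refine ⟨1 / (K + 1), fun Λ hΛ => ?_⟩
  set ℓ := 1 / (K + 1)
  obtain ⟨δ₀, hδ₀, hstep⟩ := h.exists_mirror_step hℓ hK Λ
  obtain ⟨n, hn⟩ := exists_nat_gt ((Λ - ℓ) / δ₀)
  have hn0 : (0 : ℝ) < n := lt_of_le_of_lt (div_nonneg (by linarith) hδ₀.le) hn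
  rw [div_lt_iff₀ hδ₀] at hn
  have hd0 : 0 ≤ (Λ - ℓ) / n := div_nonneg (by linarith) hn0.le
  have hd1 : (Λ - ℓ) / n ≤ δ₀ := by
    rw [div_le_iff₀ hn0]
    linarith
  have hdn : n * ((Λ - ℓ) / n) = Λ - ℓ := by field_simp
  have key : ∀ m : ℕ, m ≤ n → IncreasesUnderMirror i₀ i u (ℓ + m * ((Λ - ℓ) / n)) := by
    intro m
    induction m with
    | zero =>
      intro _
      simpa using h.increasesUnderMirror_of_narrow hℓ hK
    | succ m ih =>
      intro hm
      have h1 : (m : ℝ) * ((Λ - ℓ) / n) ≤ n * ((Λ - ℓ) / n) :=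
        mul_le_mul_of_nonneg_right (by exact_mod_cast (Nat.le_of_succ_le hm)) hd0
      have h2 : 0 ≤ (m : ℝ) * ((Λ - ℓ) / n) := by positivity
      have := hstep _ (by linarith) (by linarith) (ih (Nat.le_of_succ_le hm)) _ hd0 hd1
      convert this using 1
      push_cast
      ring
  have := key n le_rfl
  rwa [hdn, add_sub_cancel] at this

end QuarterSolution

/-! ### Behaviour far away from the boundary -/

theorem exists_tendsto_sSup_image {X : Type*} {T : ℝ → Set X} (hT : Antitone T)
    (hne : ∀ A, (T A).Nonempty) {v : X → ℝ} {b B : ℝ}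
    (hv : ∀ A, ∀ x ∈ T A, b ≤ v x ∧ v x ≤ B) :
    ∃ M, Tendsto (fun A => sSup (v '' T A)) atTop (nhds M) ∧
      (∀ ε > 0, ∃ A, ∀ x ∈ T A, v x ≤ M + ε) ∧ ∀ ε > 0, ∀ A, ∃ x ∈ T A, M - ε < v x := by
  have hbdd : ∀ A, BddAbove (v '' T A) := by
    rintro A
    refine ⟨B, ?_⟩
    rintro _ ⟨x, hx, rfl⟩
    exact (hv A x hx).2
  have hanti : Antitone fun A => sSup (v '' T A) := fun A A' hA =>
    csSup_le_csSup (hbdd A) ((hne A').image v) (image_mono (hT hA))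
  have hbelow : BddBelow (range fun A => sSup (v '' T A)) := by
    refine ⟨b, ?_⟩
    rintro _ ⟨A, rfl⟩
    obtain ⟨x, hx⟩ := hne A
    exact (hv A x hx).1.trans (le_csSup (hbdd A) (mem_image_of_mem v hx))
  have hlim := tendsto_atTop_ciInf hanti hbelow
  refine ⟨_, hlim, fun ε hε => ?_, fun ε hε A => ?_⟩
  · obtain ⟨A, hA⟩ := exists_lt_of_ciInf_lt (lt_add_of_pos_right (⨅ A, sSup (v '' T A)) hε)
    exact ⟨A, fun x hx => (le_csSup (hbdd A) (mem_image_of_mem v hx)).trans hA.le⟩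
  · have h1 : (⨅ A, sSup (v '' T A)) - ε < sSup (v '' T A) := by
      linarith [ciInf_le hbelow A]
    obtain ⟨_, ⟨x, hx, rfl⟩, h2⟩ := exists_lt_of_lt_csSup ((hne A).image v) h1
    exact ⟨x, hx, h2⟩

theorem lap_sub_const {N : ℕ} {u : (Fin N → ℝ) → ℝ} {x : Fin N → ℝ} (hu : ContDiffAt ℝ 2 u x)
    (a : ℝ) : lap (fun y => u y - a) x = lap u x := by
  rw [lap_sub hu contDiffAt_const]
  simp [lap, pd]

namespace QuarterSolution

variable {N : ℕ} {i₀ i : Fin N} {f : ℝ → ℝ} {u : (Fin N → ℝ) → ℝ} {B K F : ℝ}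

theorem abs_update_sub_le (h : QuarterSolution i₀ i f u B K F) (j : Fin N) {x : Fin N → ℝ}
    (h0 : 2 < x i₀) (h1 : 2 < x i) {a : ℝ} (ha : |a - x j| ≤ 1) :
    |u (Function.update x j a) - u x| ≤ 2 * (N * B + F + 1) * |a - x j| := by
  have hB := h.B_nonneg
  have hF := h.F_nonneg
  have hC : 0 ≤ 2 * (N * B + F + 1) := by positivity
  have habs := abs_le.1 ha
  set z := Function.update x j ((a + x j) / 2) with hz
  have hzk : ∀ k, 2 < x k → 1 < z k := by
    intro k hk
    by_cases hkj : k = j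
    · subst hkj
      rw [hz, Function.update_self]
      linarith
    · rw [hz, Function.update_of_ne hkj]
      linarith
  have key := h.abs_sub_update_le one_pos j (hzk i₀ h0) (hzk i h1)
    (t := |a - x j| / 2) (by positivity) (by linarith)
  have ex : Function.update x j (x j) = x := Function.update_eq_self j x
  have e : |u (Function.update x j a) - u x| ≤ 2 * (N * B + F + 1) * (|a - x j| / 2) := by
    simp only [hz, Function.update_self, Function.update_idem, one_pow, div_one, mul_one] at key
    rcases le_total (x j) a with hle | hle
    · rw [abs_of_nonneg (by linarith : 0 ≤ a - x j)] at key ⊢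
      have e1 : (a + x j) / 2 + (a - x j) / 2 = a := by ring
      have e2 : (a + x j) / 2 - (a - x j) / 2 = x j := by ring
      rwa [e1, e2, ex] at key
    · rw [abs_of_nonpos (by linarith : a - x j ≤ 0)] at key ⊢
      have e1 : (a + x j) / 2 + -(a - x j) / 2 = x j := by ring
      have e2 : (a + x j) / 2 - -(a - x j) / 2 = a := by ring
      rwa [e1, e2, ex, abs_sub_comm] at key
  refine e.trans (mul_le_mul_of_nonneg_left ?_ hC)
  linarith [abs_nonneg (a - x j)]

theorem exists_abs_sub_le (h : QuarterSolution i₀ i f u B K F) {θ : ℝ} (hθ : 0 < θ) :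
    ∃ ρ > 0, ∀ p : Fin N → ℝ, 3 < p i₀ → 3 < p i → ∀ x, sqd x p ≤ ρ ^ 2 → |u x - u p| ≤ θ := by
  have hB := h.B_nonneg
  have hF := h.F_nonneg
  set C := 2 * (N * B + F + 1) with hC
  have hC0 : 0 < C := by positivity
  set ρ := min 1 (θ / (C * (N + 1))) with hρ
  have hρ0 : 0 < ρ := by positivity
  have hρ1 : ρ ≤ 1 := min_le_left _ _
  have hρθ : ρ * (C * (N + 1)) ≤ θ :=
    (le_div_iff₀ (by positivity)).1 (min_le_right _ _)
  refine ⟨ρ, hρ0, fun p hp0 hp1 x hx => ?_⟩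
  have hxj := abs_sub_le_of_sqd_le hρ0.le hx
  have key : ∀ S : Finset (Fin N), |u (S.piecewise x p) - u p| ≤ S.card * (C * ρ) := by
    intro S
    induction S using Finset.induction_on with
    | empty => simp
    | insert j S hj ih =>
      rw [Finset.piecewise_insert, Finset.card_insert_of_notMem hj]
      have hpk : ∀ k, 3 < p k → 2 < S.piecewise x p k := by
        intro k hk
        by_cases hkS : k ∈ S
        · rw [Finset.piecewise_eq_of_mem _ _ _ hkS]
          linarith [(abs_le.1 (hxj k)).1]
        · rw [Finset.piecewise_eq_of_notMem _ _ _ hkS]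
          linarith
      have ej : S.piecewise x p j = p j := Finset.piecewise_eq_of_notMem _ _ _ hj
      have h1 := h.abs_update_sub_le j (hpk i₀ hp0) (hpk i hp1) (a := x j)
        (by rw [ej]; exact (hxj j).trans hρ1)
      rw [ej] at h1
      have h2 := h1.trans (mul_le_mul_of_nonneg_left (hxj j) hC0.le)
      have h3 := abs_sub_le (u (Function.update (S.piecewise x p) j (x j)))
        (u (S.piecewise x p)) (u p)
      push_cast
      linarith
  have hk := key Finset.univ
  rw [Finset.piecewise_univ, Finset.card_univ, Fintype.card_fin] at hk
  have : 0 < C * ρ := by positivity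
  linarith

/-- If `m` is the infimum of `u` far away from the boundary, then `u` cannot exceed `m` by a fixed
amount arbitrarily far away from the boundary. -/
theorem not_exists_far_above (h : QuarterSolution i₀ i f u B K F) {m θ : ℝ} (hm : 0 < m)
    (hlow : ∀ ε > 0, ∃ A, ∀ x : Fin N → ℝ, A ≤ x i₀ → A ≤ x i → m - ε ≤ u x)
    (hinf : ∀ ε > 0, ∀ A, ∃ q : Fin N → ℝ, A ≤ q i₀ ∧ A ≤ q i ∧ u q < m + ε) (hθ : 0 < θ)
    (hsup : ∀ A, ∃ p : Fin N → ℝ, A ≤ p i₀ ∧ A ≤ p i ∧ m + θ ≤ u p) : False := by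
  obtain ⟨c, hc, s₀, hs₀, hf⟩ := h.f_growth m hm.le
  have hsc : 0 < √c := Real.sqrt_pos.2 hc
  obtain ⟨R, hR, hcR⟩ : ∃ R : ℝ, 0 < R ∧ c * R ^ 2 = (N + 2) ^ 2 := by
    refine ⟨(N + 2) / √c, by positivity, ?_⟩
    rw [div_pow, Real.sq_sqrt hc.le]
    field_simp
  have hR2 : 0 < R ^ 2 := by positivity
  obtain ⟨ρ, hρ, hclose⟩ := h.exists_abs_sub_le (half_pos hθ)
  obtain ⟨k, hk⟩ := exists_superharmonic_spread N hρ (r := 2 * R) (by positivity)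
  obtain ⟨κ, hκ⟩ : ∃ κ, κ = θ / 2 * (3 / 4 : ℝ) ^ k := ⟨_, rfl⟩
  have hκ0 : 0 < κ := by rw [hκ]; positivity
  obtain ⟨ε₁, hε₁, hε₁κ, hε₁s⟩ : ∃ ε₁ > 0, ε₁ < κ ∧ ε₁ ≤ s₀ :=
    ⟨min (κ / 2) s₀, by positivity, (min_le_left _ _).trans_lt (by linarith), min_le_right _ _⟩
  obtain ⟨e, he, hem, heε, hec⟩ : ∃ e > 0, e ≤ m ∧ e ≤ ε₁ / 2 ∧ e * (c * R ^ 2) ≤ ε₁ := by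
    refine ⟨min m (min (ε₁ / 2) (ε₁ / (c * R ^ 2))), by positivity, min_le_left _ _,
      (min_le_right _ _).trans (min_le_left _ _), ?_⟩
    exact (le_div_iff₀ (by positivity)).1 ((min_le_right _ _).trans (min_le_right _ _))
  obtain ⟨A, hA⟩ := hlow (e / 2) (half_pos he)
  have hA0 : A ≤ max A 3 := le_max_left _ _
  have hA3 : 3 ≤ max A 3 := le_max_right _ _
  obtain ⟨p, hp0, hp1, hp⟩ := hsup (max A 3 + 2 * R + 1)
  obtain ⟨q, hq0, hq1, hq⟩ := hinf (ε₁ / 2) (half_pos hε₁) (max A 3 + 2 * R + 1)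
  have hD : ∀ x : Fin N → ℝ, A ≤ x i₀ ∧ A ≤ x i ∧ 0 < x i₀ ∧ 0 < x i →
      ContDiffAt ℝ 2 u x ∧ lap u x + f (u x) = 0 ∧ m - e < u x := by
    rintro x ⟨h1, h2, h3, h4⟩
    exact ⟨h.smooth x h3 h4, h.pde x h3 h4, by linarith [hA x h1 h2]⟩
  have hball : ∀ y : Fin N → ℝ, max A 3 + 2 * R + 1 ≤ y i₀ → max A 3 + 2 * R + 1 ≤ y i →
      ∀ x, sqd x y ≤ (2 * R) ^ 2 → A ≤ x i₀ ∧ A ≤ x i ∧ 0 < x i₀ ∧ 0 < x i := by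
    intro y hy0 hy1 x hx
    have h1 := (abs_le.1 (abs_sub_le_of_sqd_le (by linarith) hx i₀)).1
    have h2 := (abs_le.1 (abs_sub_le_of_sqd_le (by linarith) hx i)).1
    refine ⟨?_, ?_, ?_, ?_⟩ <;> linarith
  have hR4 : R ^ 2 ≤ (2 * R) ^ 2 := by nlinarith
  have hspread := hk (fun x => u x - (m - e)) p (θ / 2) (half_pos hθ)
    (fun x hx => ((hD x (hball p hp0 hp1 x hx)).1.sub contDiffAt_const).continuousAt
      |>.continuousWithinAt)
    (fun x hx => by
      have hb := hball p hp0 hp1 x hx.le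
      refine ⟨(hD x hb).1.sub contDiffAt_const, ?_⟩
      rw [lap_sub_const (hD x hb).1]
      exact h.lap_nonpos hb.2.2.1 hb.2.2.2)
    (fun x hx => by linarith [(hD x (hball p hp0 hp1 x hx)).2.2])
    (fun x hx _ => by
      have := (abs_le.1 (hclose p (by linarith) (by linarith) x hx)).1
      linarith)
  have key := bump_lt_of_homotopy (f := f) (u := u)
    (D := {x | A ≤ x i₀ ∧ A ≤ x i ∧ 0 < x i₀ ∧ 0 < x i}) (a := m - e) (c := c) (e := e) (R := R)
    (ε₁ := ε₁) hD ?_ hR hcR (ε := fun _ => ε₁) (y := fun t j => (1 - t) * p j + t * q j)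
    continuous_const (by fun_prop) (fun t _ => ⟨hε₁, le_rfl, by linarith⟩) ?_ ?_ q ?_
  · simp only [sub_self, zero_mul, one_mul, zero_add, sqd_self, zero_div, sub_zero, one_pow,
      mul_one] at key
    linarith
  · intro s hs hs1
    rcases le_total e s with hes | hes
    · have := hf (s - e) (by linarith) (by linarith)
      have e1 : m + (s - e) = m - e + s := by ring
      rwa [e1] at this
    · have h1 := h.f_nonneg (m - e + s) (by linarith)
      have h2 : c * (s - e) ≤ 0 := mul_nonpos_of_nonneg_of_nonpos hc.le (by linarith)
      linarith
  · rintro t ⟨ht0, ht1⟩ x hx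
    refine hball _ ?_ ?_ x (hx.trans hR4)
    · have h1 := mul_le_mul_of_nonneg_left hp0 (by linarith : 0 ≤ 1 - t)
      have h2 := mul_le_mul_of_nonneg_left hq0 ht0
      linarith
    · have h1 := mul_le_mul_of_nonneg_left hp1 (by linarith : 0 ≤ 1 - t)
      have h2 := mul_le_mul_of_nonneg_left hq1 ht0
      linarith
  · intro x hx
    have e0 : (fun j => (1 - (0 : ℝ)) * p j + 0 * q j) = p := by
      funext j
      ring
    simp only [e0] at hx ⊢
    have h1 := hspread x (hx.trans hR4)
    have h2 : (3 / 4 : ℝ) ≤ ((2 * R) ^ 2 - sqd x p) / (2 * R) ^ 2 := by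
      rw [le_div_iff₀ (by positivity)]
      linarith
    have h3 : (3 / 4 : ℝ) ^ k ≤ (((2 * R) ^ 2 - sqd x p) / (2 * R) ^ 2) ^ k :=
      pow_le_pow_left₀ (by norm_num) h2 k
    have h4 := mul_le_mul_of_nonneg_left h3 (half_pos hθ).le
    have h5 : 0 ≤ sqd x p / R ^ 2 := div_nonneg (sqd_nonneg _ _) hR2.le
    have h6 : sqd x p / R ^ 2 ≤ 1 := (div_le_one hR2).2 hx
    have h7 : (1 - sqd x p / R ^ 2) ^ 2 ≤ 1 := pow_le_one₀ (by linarith) (by linarith)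
    have h8 : ε₁ * (1 - sqd x p / R ^ 2) ^ 2 ≤ ε₁ * 1 := mul_le_mul_of_nonneg_left h7 hε₁.le
    linarith
  · simp only [sub_self, zero_mul, one_mul, zero_add, sqd_self]
    exact hR2.le

theorem eq_zero_of_tendsto_far (h : QuarterSolution i₀ i f u B K F) {M : ℝ} (hM : 0 ≤ M)
    (hfar : ∀ ε > 0, ∃ A, ∀ x : Fin N → ℝ, A ≤ x i₀ → A ≤ x i → |u x - M| ≤ ε) : f M = 0 := by
  have hK := h.K_nonneg
  have hN : (0 : ℝ) < N := by
    exact_mod_cast Nat.pos_of_ne_zero (by rintro rfl; exact i.elim0)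
  refine le_antisymm ?_ (h.f_nonneg M hM)
  by_contra! hfM
  obtain ⟨α, hα⟩ : ∃ α, α = f M / (8 * N) := ⟨_, rfl⟩
  have hα0 : 0 < α := by rw [hα]; positivity
  have hαN : α * (8 * N) = f M := by rw [hα]; field_simp
  obtain ⟨ε, hε, hεα, hεK⟩ : ∃ ε > 0, ε ≤ α / 4 ∧ ε * (2 * (K + 1)) ≤ f M :=
    ⟨min (α / 4) (f M / (2 * (K + 1))), by positivity, min_le_left _ _,
      (le_div_iff₀ (by positivity)).1 (min_le_right _ _)⟩
  have hMB : M ≤ B := by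
    refine le_of_forall_pos_le_add fun ε hε => ?_
    obtain ⟨A, hA⟩ := hfar ε hε
    have h1 := (abs_le.1 (hA (fun _ => max A 1) (le_max_left _ _) (le_max_left _ _))).1
    have h2 : 0 < max A 1 := lt_max_of_lt_right one_pos
    linarith [h.le (fun _ => max A 1) h2 h2.le]
  obtain ⟨A, hA⟩ := hfar ε hε
  obtain ⟨y, hy⟩ : ∃ y : Fin N → ℝ, y = fun _ => max A 0 + 2 := ⟨_, rfl⟩
  have hball : ∀ x, sqd x y ≤ 1 ^ 2 → ContDiffAt ℝ 2 u x ∧ |u x - M| ≤ ε ∧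
      lap u x ≤ -(f M / 2) := by
    intro x hx
    have h1 : ∀ j, A ≤ x j ∧ 0 < x j := by
      intro j
      have h2 := (abs_le.1 (abs_sub_le_of_sqd_le one_pos.le hx j)).1
      simp only [hy] at h2
      have h3 := le_max_left A 0
      have h4 := le_max_right A 0
      constructor <;> linarith
    have h2 := hA x (h1 i₀).1 (h1 i).1
    refine ⟨h.smooth x (h1 i₀).2 (h1 i).2, h2, ?_⟩
    have h3 := h.pde x (h1 i₀).2 (h1 i).2
    have h4 := h.f_lip (u x) M (h.nonneg x (h1 i₀).2 (h1 i).2.le) (h.le x (h1 i₀).2 (h1 i).2.le)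
      hM hMB
    have h5 := (abs_le.1 (h4.trans (mul_le_mul_of_nonneg_left h2 hK))).1
    linarith
  have hψ : ContDiff ℝ 2 fun x => M - ε + α * (1 - sqd x y) := by
    have := contDiff_sqd y
    fun_prop
  have hlap : ∀ x, lap (fun x => M - ε + α * (1 - sqd x y)) x = -(2 * N * α) := by
    intro x
    have := lap_radial (g := fun s => M - ε + α * (1 - s)) (g' := fun _ => -α) (g'' := fun _ => 0)
      (fun s => by
        refine ((((hasDerivAt_id s).const_sub 1).const_mul α).const_add _).congr_deriv ?_
        ring) (fun s => hasDerivAt_const s _) y x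
    rw [this]
    ring
  have key := nonneg_of_lap_neg (isCompact_sqd_le y 1)
    (w := fun x => u x - (M - ε + α * (1 - sqd x y)))
    (fun x hx => ((hball x hx).1.sub hψ.contDiffAt).continuousAt.continuousWithinAt) ?_ y ?_
  · have h1 := (abs_le.1 (hball y (by rw [sqd_self]; norm_num)).2.1).2
    simp only [sqd_self] at key
    linarith
  · intro x hx hneg
    obtain ⟨h1, h2, h3⟩ := hball x hx
    have h4 := (abs_le.1 h2).1
    have h5 : sqd x y < 1 ^ 2 := by
      refine lt_of_le_of_ne hx fun he => ?_
      simp only [he] at hneg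
      linarith
    refine ⟨?_, h1.sub hψ.contDiffAt, ?_⟩
    · filter_upwards [sqd_lt_mem_nhds h5] with z hz using le_of_lt hz
    · rw [lap_sub h1 hψ.contDiffAt, hlap]
      linarith
  · change sqd y y ≤ 1 ^ 2
    rw [sqd_self]
    norm_num

theorem exists_limit (h : QuarterSolution i₀ i f u B K F) :
    ∃ M, Tendsto (fun A : ℝ => sSup (u '' {x : Fin N → ℝ | A ≤ x i₀ ∧ 0 ≤ x i})) atTop (nhds M) ∧
      0 < M ∧ f M = 0 := by
  obtain ⟨ε₀, hε₀, A₀, hA₀⟩ := h.exists_lower_bound one_pos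
  have hcut : ∀ {A t : ℝ}, max A 1 ≤ t → A ≤ t ∧ 1 ≤ t := fun ht =>
    ⟨(le_max_left _ _).trans ht, (le_max_right _ _).trans ht⟩
  obtain ⟨M, hM, hMle, hMlt⟩ := exists_tendsto_sSup_image
    (T := fun A => {x : Fin N → ℝ | max A 1 ≤ x i₀ ∧ 0 ≤ x i}) (v := u) (b := 0) (B := B)
    (fun A A' hA x hx => ⟨(max_le_max_right 1 hA).trans hx.1, hx.2⟩)
    (fun A => ⟨fun _ => max A 1, le_rfl, zero_le_one.trans (le_max_right _ _)⟩)
    (fun A x hx => ⟨h.nonneg x (by linarith [(hcut hx.1).2]) hx.2,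
      h.le x (by linarith [(hcut hx.1).2]) hx.2⟩)
  obtain ⟨m', -, hm'le, hm'lt⟩ := exists_tendsto_sSup_image
    (T := fun A => {x : Fin N → ℝ | max A 1 ≤ x i₀ ∧ max A 1 ≤ x i}) (v := fun x => -u x)
    (b := -B) (B := 0)
    (fun A A' hA x hx => ⟨(max_le_max_right 1 hA).trans hx.1, (max_le_max_right 1 hA).trans hx.2⟩)
    (fun A => ⟨fun _ => max A 1, le_rfl, le_rfl⟩)
    (fun A x hx => ⟨neg_le_neg (h.le x (by linarith [(hcut hx.1).2]) (by linarith [(hcut hx.2).2])),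
      neg_nonpos.2 (h.nonneg x (by linarith [(hcut hx.1).2]) (by linarith [(hcut hx.2).2]))⟩)
  have hm0 : 0 < -m' := by
    obtain ⟨x, ⟨hx0, hx1⟩, hx⟩ := hm'lt (ε₀ / 2) (half_pos hε₀) A₀
    linarith [hA₀ x (hcut hx0).1 (hcut hx1).2]
  have hM0 : 0 < M := by
    obtain ⟨A, hA⟩ := hMle (ε₀ / 2) (half_pos hε₀)
    have h1 : max A 1 ≤ max (max A 1) A₀ := le_max_left _ _
    have h2 := hA (fun _ => max (max A 1) A₀) ⟨h1, by linarith [(hcut h1).2]⟩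
    linarith [hA₀ (fun _ => max (max A 1) A₀) (le_max_right _ _) (hcut h1).2]
  have hfarsup : ∀ ε > 0, ∀ A, ∃ p : Fin N → ℝ, A ≤ p i₀ ∧ A ≤ p i ∧ M - ε ≤ u p := by
    intro ε hε A
    obtain ⟨ℓ, hℓ⟩ := h.exists_increasesUnderMirror
    obtain ⟨A', hA'⟩ := hℓ (max A ℓ) (le_max_right _ _) (ε / 2) (half_pos hε)
    obtain ⟨x, ⟨hx0, hx1⟩, hx⟩ := hMlt (ε / 2) (half_pos hε) (max A A')
    have k1 := (le_max_left A A').trans (hcut hx0).1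
    have k2 := (le_max_right A A').trans (hcut hx0).1
    rcases le_total A (x i) with h1 | h1
    · exact ⟨x, k1, h1, by linarith⟩
    · have k3 : A ≤ max A ℓ := le_max_left _ _
      refine ⟨mirror i (max A ℓ) x, ?_, ?_, ?_⟩
      · rwa [mirror_apply_of_ne h.ne]
      · rw [mirror_apply_self]
        linarith
      · linarith [hA' x k2 hx1 (h1.trans k3)]
  have hMm : M ≤ -m' := by
    by_contra! hlt
    refine h.not_exists_far_above (θ := (M + m') / 2) hm0 (fun ε hε => ?_) (fun ε hε A => ?_)
      (by linarith) fun A => ?_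
    · obtain ⟨A, hA⟩ := hm'le ε hε
      refine ⟨max A 1, fun x h0 h1 => ?_⟩
      linarith [hA x ⟨h0, h1⟩]
    · obtain ⟨x, ⟨hx0, hx1⟩, hx⟩ := hm'lt ε hε A
      exact ⟨x, (hcut hx0).1, (hcut hx1).1, by linarith⟩
    · obtain ⟨p, hp0, hp1, hp⟩ := hfarsup ((M + m') / 2) (by linarith) A
      exact ⟨p, hp0, hp1, by linarith⟩
  refine ⟨M, hM.congr' ?_, hM0, h.eq_zero_of_tendsto_far hM0.le fun ε hε => ?_⟩
  · filter_upwards [eventually_ge_atTop 1] with A hA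
    rw [max_eq_left hA]
  · obtain ⟨A, hA⟩ := hMle ε hε
    obtain ⟨A', hA'⟩ := hm'le ε hε
    refine ⟨max (max A 1) (max A' 1), fun x h0 h1 => ?_⟩
    have a0 := (le_max_left _ _).trans h0
    have a1 := (le_max_left _ _).trans h1
    have h2 := hA x ⟨a0, by linarith [(hcut a1).2]⟩
    have h3 := hA' x ⟨(le_max_right _ _).trans h0, (le_max_right _ _).trans h1⟩
    rw [abs_le]
    constructor <;> linarith

end QuarterSolution

/-- Under (H2), `f` grows at least linearly to the right of every `m ≥ 0`. -/
lemma H2.exists_mul_le {f : ℝ → ℝ} (hf : H2 f) {m : ℝ} (hm : 0 ≤ m) :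
    ∃ c > 0, ∃ s₀ > 0, ∀ s, 0 ≤ s → s ≤ s₀ → c * s ≤ f (m + s) := by
  obtain ⟨hlip, hnonneg, hzero⟩ := hf
  rcases (hnonneg m hm).eq_or_lt with h0 | h0
  · obtain ⟨c, hc, hev⟩ := hzero m hm h0.symm
    obtain ⟨b, hb, hsub⟩ := mem_nhdsGT_iff_exists_Ioc_subset.1 hev
    have hb' : m < b := hb
    refine ⟨c, hc, b - m, by linarith, fun s hs hsb => ?_⟩
    rcases hs.eq_or_lt with rfl | hs
    · simp [← h0]
    · have h1 : c ≤ f (m + s) / (m + s - m) :=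
        hsub ⟨by linarith, by linarith⟩
      rw [add_sub_cancel_left] at h1
      exact (le_div_iff₀ hs).1 h1
  · obtain ⟨L, hL⟩ := hlip (m + 1)
    have hL0 : (0 : ℝ) ≤ L := L.2
    have hden : 0 < (L : ℝ) + 1 := by linarith
    refine ⟨1, one_pos, min 1 (f m / (L + 1)), lt_min one_pos (div_pos h0 hden),
      fun s hs hsb => ?_⟩
    have h1 := hL.dist_le_mul (m + s) ⟨by linarith, by linarith [hsb.trans (min_le_left _ _)]⟩
      m ⟨hm, by linarith⟩
    rw [Real.dist_eq, Real.dist_eq, add_sub_cancel_left, abs_of_nonneg hs] at h1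
    have h2 := (le_div_iff₀ hden).1 (hsb.trans (min_le_right _ _))
    linarith [(abs_le.1 h1).1]

/-- A nonnegative supersolution in the quarter-space, continuous up to the face `x i₀ = 0`, that
is positive somewhere on that face is positive inside. -/
lemma pos_of_pos_on_face {N : ℕ} {i₀ i : Fin N} (hne : i₀ ≠ i) {u : (Fin N → ℝ) → ℝ}
    (hu : ∀ x : Fin N → ℝ, 0 < x i₀ → 0 < x i → ContDiffAt ℝ 2 u x ∧ lap u x ≤ 0 ∧ 0 ≤ u x)
    {y : Fin N → ℝ} (hy₀ : y i₀ = 0) (hy : 0 < y i) (huy : 0 < u y)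
    (hcont : ContinuousWithinAt u {x : Fin N → ℝ | 0 < x i₀ ∧ 0 < x i} y) :
    ∀ x : Fin N → ℝ, 0 < x i₀ → 0 < x i → 0 < u x := by
  have hopen : IsOpen {x : Fin N → ℝ | 0 < x i₀ ∧ 0 < x i} :=
    (isOpen_lt continuous_const (continuous_apply i₀)).inter
      (isOpen_lt continuous_const (continuous_apply i))
  have hconv : Convex ℝ {x : Fin N → ℝ | 0 < x i₀ ∧ 0 < x i} := by
    rintro x ⟨hx₀, hx⟩ z ⟨hz₀, hz⟩ a b ha hb hab
    have key : ∀ p q : ℝ, 0 < p → 0 < q → 0 < a * p + b * q := fun p q hp hq =>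
      convex_Ioi (0 : ℝ) hp hq ha hb hab
    exact ⟨key _ _ hx₀ hz₀, key _ _ hx hz⟩
  have hpath : Tendsto (fun t : ℝ => Function.update y i₀ t) (nhdsWithin 0 (Ioi 0))
      (nhdsWithin y {x : Fin N → ℝ | 0 < x i₀ ∧ 0 < x i}) := by
    refine tendsto_nhdsWithin_iff.2 ⟨?_, ?_⟩
    · have h1 : Continuous fun t : ℝ => Function.update y i₀ t :=
        continuous_const.update i₀ continuous_id
      have h2 : Function.update y i₀ 0 = y := by rw [← hy₀, Function.update_eq_self]
      have h3 := h1.tendsto 0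
      rw [h2] at h3
      exact h3.mono_left nhdsWithin_le_nhds
    · filter_upwards [self_mem_nhdsWithin] with t ht
      refine ⟨?_, ?_⟩
      · rw [Function.update_self]
        exact ht
      · rw [Function.update_of_ne hne.symm]
        exact hy
  obtain ⟨t, ht, htm⟩ := (((hcont.tendsto.comp hpath).eventually (lt_mem_nhds huy)).and
    (hpath.eventually self_mem_nhdsWithin)).exists
  exact fun x hx₀ hx => pos_of_lap_nonpos hopen hconv.isPreconnected
    (fun x hx => hu x hx.1 hx.2) ⟨_, htm, ht⟩ x ⟨hx₀, hx⟩

/-- In the proof of Theorem 1.2: under (H2), for any nontrivial bounded nonnegative solution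
of the quarter-space problem, the limit
`M = lim_{A→+∞} sup_{[A,+∞)×ℝ^{N-2}×[0,+∞)} u` exists, is finite and positive, and
`f(M) = 0`. -/
theorem stmt_18
    (f : ℝ → ℝ) (hf : H2 f)
    {N : ℕ} (hN : 2 ≤ N) (i0 iN : Fin N) (hi0 : (i0 : ℕ) = 0) (hiN : (iN : ℕ) = N - 1)
    (u u₀ : (Fin N → ℝ) → ℝ)
    (hu_smooth : ContDiffOn ℝ 2 u {x : Fin N → ℝ | 0 < x i0 ∧ 0 < x iN})
    (hu_cont : ContinuousOn u
      ({x : Fin N → ℝ | 0 ≤ x i0 ∧ 0 ≤ x iN} \ {x : Fin N → ℝ | x i0 = 0 ∧ x iN = 0}))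
    (hu_nonneg : ∀ x : Fin N → ℝ, 0 ≤ x i0 → 0 ≤ x iN → ¬(x i0 = 0 ∧ x iN = 0) → 0 ≤ u x)
    (hu_bdd : ∃ C, ∀ x : Fin N → ℝ, 0 ≤ x i0 → 0 ≤ x iN → ¬(x i0 = 0 ∧ x iN = 0) → u x ≤ C)
    (hu_pde : ∀ x : Fin N → ℝ, 0 < x i0 → 0 < x iN → lap u x + f (u x) = 0)
    (hu_bot : ∀ x : Fin N → ℝ, 0 < x i0 → x iN = 0 → u x = 0)
    (hu_init : ∀ x : Fin N → ℝ, x i0 = 0 → 0 < x iN → u x = u₀ x)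
    (hu₀_cont : ContinuousOn u₀ {x : Fin N → ℝ | x i0 = 0 ∧ 0 < x iN})
    (hu₀_bdd : ∃ C, ∀ x : Fin N → ℝ, x i0 = 0 → 0 < x iN → u₀ x ≤ C)
    (hu₀_nonneg : ∀ x : Fin N → ℝ, x i0 = 0 → 0 < x iN → 0 ≤ u₀ x)
    (hu₀_ne : ∃ x : Fin N → ℝ, x i0 = 0 ∧ 0 < x iN ∧ u₀ x ≠ 0) :
    ∃ M : ℝ,
      Filter.Tendsto
        (fun A : ℝ => sSup (u '' {x : Fin N → ℝ | A ≤ x i0 ∧ 0 ≤ x iN}))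
        Filter.atTop (nhds M) ∧
      0 < M ∧ f M = 0 := by
  have hne : i0 ≠ iN := by
    intro h
    have := congrArg Fin.val h
    omega
  obtain ⟨C, hC⟩ := hu_bdd
  obtain ⟨L, hL⟩ := hf.1 (max C 0)
  have hB : (0 : ℝ) ≤ max C 0 := le_max_right _ _
  have hL0 : (0 : ℝ) ≤ L := L.2
  have hlip : ∀ s t, 0 ≤ s → s ≤ max C 0 → 0 ≤ t → t ≤ max C 0 →
      |f s - f t| ≤ L * |s - t| := by
    intro s t hs hs' ht ht'
    simpa [Real.dist_eq] using hL.dist_le_mul s ⟨hs, hs'⟩ t ⟨ht, ht'⟩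
  have hopen : IsOpen {x : Fin N → ℝ | 0 < x i0 ∧ 0 < x iN} :=
    (isOpen_lt continuous_const (continuous_apply i0)).inter
      (isOpen_lt continuous_const (continuous_apply iN))
  have hsmooth : ∀ x : Fin N → ℝ, 0 < x i0 → 0 < x iN → ContDiffAt ℝ 2 u x := fun x hx₀ hx =>
    hu_smooth.contDiffAt (hopen.mem_nhds ⟨hx₀, hx⟩)
  have hnonneg : ∀ x : Fin N → ℝ, 0 < x i0 → 0 ≤ x iN → 0 ≤ u x := fun x hx₀ hx =>
    hu_nonneg x hx₀.le hx fun h => hx₀.ne' h.1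
  obtain ⟨y, hy₀, hy, huy⟩ := hu₀_ne
  have hpos : ∀ x : Fin N → ℝ, 0 < x i0 → 0 < x iN → 0 < u x := by
    refine pos_of_pos_on_face hne (fun x hx₀ hx => ⟨hsmooth x hx₀ hx, ?_, hnonneg x hx₀ hx.le⟩)
      hy₀ hy ?_ ?_
    · linarith [hu_pde x hx₀ hx, hf.2.1 _ (hnonneg x hx₀ hx.le)]
    · rw [hu_init y hy₀ hy]
      exact lt_of_le_of_ne (hu₀_nonneg y hy₀ hy) huy.symm
    · exact (hu_cont y ⟨⟨hy₀.ge, hy.le⟩, fun h => hy.ne' h.2⟩).mono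
        fun x hx => ⟨⟨hx.1.le, hx.2.le⟩, fun h => hx.1.ne' h.1⟩
  have hsol : QuarterSolution i0 iN f u (max C 0) L (f 0 + L * max C 0) :=
    { ne := hne
      B_nonneg := hB
      K_nonneg := hL0
      F_nonneg := add_nonneg (hf.2.1 0 le_rfl) (mul_nonneg hL0 hB)
      f_nonneg := hf.2.1
      f_lip := hlip
      f_le := by
        intro s hs hs'
        have h1 := hlip s 0 hs hs' le_rfl hB
        rw [sub_zero, abs_of_nonneg hs] at h1
        linarith [(abs_le.1 h1).2, mul_le_mul_of_nonneg_left hs' hL0]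
      f_growth := fun m hm => hf.exists_mul_le hm
      cont := hu_cont.mono fun x hx => ⟨⟨hx.1.le, hx.2⟩, fun h => hx.1.ne' h.1⟩
      smooth := hsmooth
      pde := hu_pde
      bot := hu_bot
      nonneg := hnonneg
      le := fun x hx₀ hx => (hC x hx₀.le hx fun h => hx₀.ne' h.1).trans (le_max_left _ _)
      pos := hpos }
  exact hsol.exists_limit
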